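/- In the main setup below, for every i = 1,…,k−1 there exist times t_ε^i with t_ε^i → t_i as ε → 0 such that the rescaled functions v_ε^i(s) := u_ε(t_ε^i + ε s) converge to the heteroclinic solution v_i uniformly on every compact subset of ℝ as ε → 0. -/

import Mathlib

open Set Filter Topology
open scoped RealInnerProductSpace

/-- The set of pairs `(t, ξ)` with `t ∈ [0,T]` such that `ξ` is a degenerate critical
point of `f t`. -/
noncomputable def degenerateCriticalSet {n : ℕ} (T : ℝ)
    (f : ℝ → EuclideanSpace ℝ (Fin n) → ℝ) :
    Set (ℝ × EuclideanSpace ℝ (Fin n)) :=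
  {p | p.1 ∈ Set.Icc 0 T ∧ gradient (f p.1) p.2 = 0 ∧
    LinearMap.det ((fderiv ℝ (gradient (f p.1)) p.2 :
      EuclideanSpace ℝ (Fin n) →L[ℝ] EuclideanSpace ℝ (Fin n)) :
      EuclideanSpace ℝ (Fin n) →ₗ[ℝ] EuclideanSpace ℝ (Fin n)) = 0}

/-- The Hessian of `f t` at `x` is positive definite. -/
noncomputable def HessPosDef {n : ℕ} (f : ℝ → EuclideanSpace ℝ (Fin n) → ℝ)
    (t : ℝ) (x : EuclideanSpace ℝ (Fin n)) : Prop :=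
  ∀ y : EuclideanSpace ℝ (Fin n), y ≠ 0 → 0 < ⟪(fderiv ℝ (gradient (f t)) x) y, y⟫

/-- The Hessian of `f t` at `x` is positive semidefinite. -/
noncomputable def HessPosSemidef {n : ℕ} (f : ℝ → EuclideanSpace ℝ (Fin n) → ℝ)
    (t : ℝ) (x : EuclideanSpace ℝ (Fin n)) : Prop :=
  ∀ y : EuclideanSpace ℝ (Fin n), 0 ≤ ⟪(fderiv ℝ (gradient (f t)) x) y, y⟫

/-- The gradient with respect to `x` of the partial derivative `f_t`. -/
noncomputable def gradft {n : ℕ} (f : ℝ → EuclideanSpace ℝ (Fin n) → ℝ)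
    (t : ℝ) (x : EuclideanSpace ℝ (Fin n)) : EuclideanSpace ℝ (Fin n) :=
  gradient (fun z => deriv (fun s => f s z) t) x

/-- The third spatial derivative of `f t` at `x` evaluated three times at `ℓ`. -/
noncomputable def thirdDeriv {n : ℕ} (f : ℝ → EuclideanSpace ℝ (Fin n) → ℝ)
    (t : ℝ) (x ℓ : EuclideanSpace ℝ (Fin n)) : ℝ :=
  iteratedFDeriv ℝ 3 (f t) x ![ℓ, ℓ, ℓ]

section Flow

variable {E : Type*} [NormedAddCommGroup E] [InnerProductSpace ℝ E]

/-- A trajectory of `ε u' = -g(s, u)` cannot leave a tube of radius `ρ` around a curve `c` on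
whose lateral boundary `g` points outwards, once `ε` is small. -/
lemma norm_sub_le_of_tube {ε ρ M m p q : ℝ} {g : ℝ → E → E} {u c c' : ℝ → E}
    (hε : 0 < ε) (hρ : 0 ≤ ρ)
    (huc : ContinuousOn u (Icc p q)) (hcc : ContinuousOn c (Icc p q))
    (hu : ∀ s ∈ Ico p q, HasDerivWithinAt u (-(ε⁻¹ • g s (u s))) (Ici s) s)
    (hc : ∀ s ∈ Ico p q, HasDerivWithinAt c (c' s) (Ici s) s)
    (hin : ∀ s ∈ Ico p q, ∀ z, ‖z - c s‖ = ρ → m ≤ ⟪z - c s, g s z⟫)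
    (hM : ∀ s ∈ Ico p q, ‖c' s‖ ≤ M) (hεm : ε * (ρ * M) < m)
    (h0 : ‖u p - c p‖ ≤ ρ) :
    ∀ s ∈ Icc p q, ‖u s - c s‖ ≤ ρ := by
  intro s hs
  have key : ‖u s - c s‖ ^ 2 ≤ ρ ^ 2 := by
    refine image_le_of_deriv_right_lt_deriv_boundary' (a := p) (b := q)
      (f := fun s => ‖u s - c s‖ ^ 2) (B := fun _ => ρ ^ 2) (B' := fun _ => 0)
      (f' := fun s => 2 * ⟪u s - c s, -(ε⁻¹ • g s (u s)) - c' s⟫)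
      ((huc.sub hcc).norm.pow 2) (fun r hr => ((hu r hr).sub (hc r hr)).norm_sq)
      (by gcongr) continuousOn_const (fun r _ => hasDerivWithinAt_const _ _ _) ?_ hs
    intro r hr hN
    have hN' : ‖u r - c r‖ = ρ := by
      have := (sq_eq_sq₀ (norm_nonneg _) hρ).1 hN
      exact this
    have h1 := hin r hr (u r) hN'
    have h2 : -(⟪u r - c r, c' r⟫) ≤ ρ * M := by
      have := abs_real_inner_le_norm (u r - c r) (c' r)
      rw [hN'] at this
      have h3 := mul_le_mul_of_nonneg_left (hM r hr) hρ
      linarith [neg_abs_le (⟪u r - c r, c' r⟫)]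
    rw [inner_sub_right, inner_neg_right, inner_smul_right]
    have h4 : ε⁻¹ * m ≤ ε⁻¹ * ⟪u r - c r, g r (u r)⟫ := by gcongr
    have h5 : ρ * M < ε⁻¹ * m := by
      rw [inv_mul_eq_div, lt_div_iff₀ hε]; linarith
    linarith
  exact le_of_sq_le_sq key hρ

/-- A Grönwall estimate for trajectories of two vector fields which are close near one of the
trajectories. -/
lemma norm_sub_le_exp_of_tube {S L e ρ : ℝ} {w v w' v' : ℝ → E}
    (he : 0 < e) (hL : 0 ≤ L)
    (hw : ∀ s ∈ Icc 0 S, HasDerivAt w (w' s) s) (hv : ∀ s ∈ Icc 0 S, HasDerivAt v (v' s) s)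
    (hwv : ∀ s ∈ Icc 0 S, ‖w s - v s‖ ≤ ρ → ‖w' s - v' s‖ ≤ L * ‖w s - v s‖ + e)
    (h0 : ‖w 0 - v 0‖ ≤ e) (hρ : e * Real.exp ((L + 2) * S) ≤ ρ) :
    ∀ s ∈ Icc 0 S, ‖w s - v s‖ ≤ e * Real.exp ((L + 2) * s) := by
  intro s hs
  have hB : ∀ r : ℝ, HasDerivAt (fun r => e * Real.exp ((L + 2) * r))
      (e * (Real.exp ((L + 2) * r) * (L + 2))) r := by
    intro r
    have := (((hasDerivAt_id r).const_mul (L + 2)).exp).const_mul e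
    simpa using this
  refine image_norm_le_of_norm_deriv_right_lt_deriv_boundary' (a := 0) (b := S)
    (f := fun s => w s - v s) (f' := fun s => w' s - v' s)
    (fun r hr => ((hw r hr).sub (hv r hr)).continuousAt.continuousWithinAt)
    (fun r hr => ((hw r (Ico_subset_Icc_self hr)).sub
      (hv r (Ico_subset_Icc_self hr))).hasDerivWithinAt)
    (B := fun r => e * Real.exp ((L + 2) * r)) (by simpa using h0)
    (fun r _ => (hB r).continuousAt.continuousWithinAt)
    (fun r _ => (hB r).hasDerivWithinAt) ?_ hs
  intro r hr hN
  have hN' : ‖w r - v r‖ = e * Real.exp ((L + 2) * r) := hN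
  have h1 : Real.exp ((L + 2) * r) ≤ Real.exp ((L + 2) * S) := by
    apply Real.exp_le_exp.2; gcongr; exact hr.2.le
  have h2 : 1 ≤ Real.exp ((L + 2) * r) := Real.one_le_exp (mul_nonneg (by linarith) hr.1)
  have h3 := hwv r (Ico_subset_Icc_self hr) (by rw [hN']; exact le_trans (by gcongr) hρ)
  rw [hN'] at h3
  have h4 : e ≤ e * Real.exp ((L + 2) * r) := le_mul_of_one_le_right he.le h2
  have h5 : 0 < e * Real.exp ((L + 2) * r) := by positivity
  change ‖w' r - v' r‖ < _
  nlinarith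

/-- The quadratic form `|D|² - (1 + θ²) ⟪D, ℓ⟫²`; for a unit vector `ℓ` it is negative exactly on
the open cone of slope `θ` around the line spanned by `ℓ`. -/
noncomputable def coneForm (θ : ℝ) (ℓ D : E) : ℝ := ‖D‖ ^ 2 - (1 + θ ^ 2) * ⟪D, ℓ⟫ ^ 2

lemma coneForm_le_norm_sq (θ : ℝ) (ℓ D : E) : coneForm θ ℓ D ≤ ‖D‖ ^ 2 := by
  unfold coneForm
  nlinarith [sq_nonneg (⟪D, ℓ⟫), sq_nonneg θ, mul_nonneg (sq_nonneg θ) (sq_nonneg (⟪D, ℓ⟫))]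

set_option maxHeartbeats 800000 in
/-- The cone form contracts along differences of trajectories of almost the same vector field. -/
lemma coneForm_sub_le {a b r e κ lam θ : ℝ} {x₀ ℓ : E} {A : E →L[ℝ] E} {G : E → E}
    {w v w' v' : ℝ → E} (hab : a ≤ b) (he : 0 ≤ e) (hlam : 0 < lam)
    (hθ0 : 0 < θ) (hθ : θ ≤ 1) (hℓ : ‖ℓ‖ = 1) (hAℓ : ∀ D, ⟪A D, ℓ⟫ = 0)
    (hgap : ∀ D, lam * (‖D‖ ^ 2 - ⟪D, ℓ⟫ ^ 2) ≤ ⟪A D, D⟫)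
    (hκ6 : 6 * κ ≤ lam * θ ^ 2)
    (hG : ∀ z₁ ∈ Metric.closedBall x₀ r, ∀ z₂ ∈ Metric.closedBall x₀ r,
      ‖G z₁ - G z₂ - A (z₁ - z₂)‖ ≤ κ * ‖z₁ - z₂‖)
    (hw : ∀ s ∈ Icc a b, HasDerivAt w (-(w' s)) s)
    (hv : ∀ s ∈ Icc a b, HasDerivAt v (-(v' s)) s)
    (hwr : ∀ s ∈ Icc a b, w s ∈ Metric.closedBall x₀ r)
    (hvr : ∀ s ∈ Icc a b, v s ∈ Metric.closedBall x₀ r)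
    (hwe : ∀ s ∈ Icc a b, ‖w' s - G (w s)‖ ≤ e)
    (hve : ∀ s ∈ Icc a b, ‖v' s - G (v s)‖ ≤ e) :
    coneForm θ ℓ (w b - v b) ≤ Real.exp (-lam * (b - a)) * (4 * r ^ 2) + 24 * r * e / lam := by
  have hdist : ∀ s ∈ Icc a b, ‖w s - v s‖ ≤ 2 * r := by
    intro s hs
    have h1 := hwr s hs
    have h2 := hvr s hs
    rw [mem_closedBall_iff_norm] at h1 h2
    calc ‖w s - v s‖ = ‖(w s - x₀) - (v s - x₀)‖ := by congr 1; abel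
      _ ≤ _ := norm_sub_le _ _
      _ ≤ 2 * r := by linarith
  have hr : 0 ≤ r := by linarith [norm_nonneg (w a - v a), hdist a ⟨le_rfl, hab⟩]
  set D : ℝ → E := fun s => w s - v s with hD
  set D' : ℝ → E := fun s => -(w' s) - -(v' s) with hD'
  have hDd : ∀ s ∈ Icc a b, HasDerivAt D (D' s) s := fun s hs => (hw s hs).sub (hv s hs)
  set Q : ℝ → ℝ := fun s => coneForm θ ℓ (D s) with hQ
  set Q' : ℝ → ℝ := fun s => 2 * ⟪D s, D' s⟫ - (1 + θ ^ 2) * (2 * ⟪D s, ℓ⟫ * ⟪D' s, ℓ⟫) with hQ'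
  have hQd : ∀ s ∈ Icc a b, HasDerivAt Q (Q' s) s := by
    intro s hs
    have h1 := (hDd s hs).norm_sq
    have h2 : HasDerivAt (fun s => ⟪D s, ℓ⟫) ⟪D' s, ℓ⟫ s := by
      have := (hDd s hs).inner ℝ (hasDerivAt_const s ℓ)
      simpa using this
    have h3 := h1.sub ((h2.pow 2).const_mul (1 + θ ^ 2))
    refine h3.congr_deriv ?_
    simp only [hQ']
    norm_num
  have hQbound : ∀ s ∈ Icc a b, Q' s ≤ -lam * Q s + 24 * r * e := by
    intro s hs
    set R : E := (w' s - v' s) - A (D s) with hR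
    have hRn : ‖R‖ ≤ κ * ‖D s‖ + 2 * e := by
      have : R = (w' s - G (w s)) - (v' s - G (v s)) + (G (w s) - G (v s) - A (w s - v s)) := by
        simp only [hR, hD]; abel
      rw [this]
      calc _ ≤ _ := norm_add_le _ _
        _ ≤ ‖w' s - G (w s)‖ + ‖v' s - G (v s)‖ + ‖G (w s) - G (v s) - A (w s - v s)‖ := by
          gcongr; exact norm_sub_le _ _
        _ ≤ _ := by
          have := hG _ (hwr s hs) _ (hvr s hs)
          have h1 := hwe s hs
          have h2 := hve s hs
          simp only [hD]; linarith
    have hD'R : D' s = -(A (D s)) - R := by simp only [hR, hD']; abel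
    set d := ‖D s‖ with hd
    have hd0 : 0 ≤ d := norm_nonneg _
    have hd2 : d ≤ 2 * r := hdist s hs
    set α := ⟪D s, ℓ⟫ with hα
    have hαd : |α| ≤ d := by
      have := abs_real_inner_le_norm (D s) ℓ
      rwa [hℓ, mul_one] at this
    have hRℓ : |⟪R, ℓ⟫| ≤ ‖R‖ := by
      have := abs_real_inner_le_norm R ℓ
      rwa [hℓ, mul_one] at this
    have hDR : |⟪D s, R⟫| ≤ d * ‖R‖ := abs_real_inner_le_norm _ _
    have e1 : ⟪D s, D' s⟫ = -⟪A (D s), D s⟫ - ⟪D s, R⟫ := by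
      rw [hD'R, inner_sub_right, inner_neg_right, real_inner_comm (A (D s))]
    have e2 : ⟪D' s, ℓ⟫ = - ⟪R, ℓ⟫ := by
      rw [hD'R, inner_sub_left, inner_neg_left, hAℓ]; simp
    have h1 := hgap (D s)
    have hprod : |α * ⟪R, ℓ⟫| ≤ d * ‖R‖ := by
      rw [abs_mul]; exact mul_le_mul hαd hRℓ (abs_nonneg _) hd0
    have h2 : Q' s ≤ -2 * lam * (d ^ 2 - α ^ 2) + 6 * (d * ‖R‖) := by
      simp only [hQ']
      rw [e1, e2]
      have a1 := neg_abs_le (⟪D s, R⟫)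
      have a2 := le_abs_self (α * ⟪R, ℓ⟫)
      have a3 : (1 + θ ^ 2) * (α * ⟪R, ℓ⟫) ≤ 2 * (d * ‖R‖) := by
        have t1 : 1 + θ ^ 2 ≤ 2 := by nlinarith
        have t2 : 0 ≤ d * ‖R‖ := by positivity
        nlinarith [sq_nonneg θ]
      nlinarith
    have h3 : d * ‖R‖ ≤ κ * d ^ 2 + 4 * r * e := by
      have := mul_le_mul_of_nonneg_left hRn hd0
      have h4 : d * e ≤ 2 * r * e := mul_le_mul_of_nonneg_right hd2 he
      nlinarith
    have h4 : Q s = d ^ 2 - (1 + θ ^ 2) * α ^ 2 := rfl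
    rw [h4]
    have hβ : 0 ≤ d ^ 2 - α ^ 2 := by
      have := sq_le_sq' (by linarith [neg_abs_le α]) ((le_abs_self α).trans hαd)
      linarith
    have hθ2 : θ ^ 2 ≤ 1 := by nlinarith
    have h5 : 6 * κ * d ^ 2 ≤ lam * (d ^ 2 - α ^ 2) + lam * θ ^ 2 * α ^ 2 := by
      have t1 : 6 * κ * (d ^ 2 - α ^ 2) ≤ lam * (d ^ 2 - α ^ 2) := by
        apply mul_le_mul_of_nonneg_right _ hβ
        nlinarith
      have t2 : 6 * κ * α ^ 2 ≤ lam * θ ^ 2 * α ^ 2 :=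
        mul_le_mul_of_nonneg_right hκ6 (sq_nonneg _)
      linarith
    linarith
  set C := 24 * r * e / lam with hC
  have hClam : lam * C = 24 * r * e := by rw [hC]; field_simp
  have hanti : AntitoneOn (fun s => Real.exp (lam * (s - a)) * (Q s - C)) (Icc a b) := by
    have hd : ∀ s ∈ Icc a b, HasDerivAt (fun s => Real.exp (lam * (s - a)) * (Q s - C))
        (Real.exp (lam * (s - a)) * lam * (Q s - C) + Real.exp (lam * (s - a)) * Q' s) s := by
      intro s hs
      have h1 : HasDerivAt (fun s => Real.exp (lam * (s - a))) (Real.exp (lam * (s - a)) * lam) s := by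
        have := (((hasDerivAt_id s).sub_const a).const_mul lam).exp
        simpa using this
      exact h1.mul ((hQd s hs).sub_const C)
    apply antitoneOn_of_deriv_nonpos (convex_Icc a b)
    · exact fun s hs => (hd s hs).continuousAt.continuousWithinAt
    · exact fun s hs => (hd s (interior_subset hs)).differentiableAt.differentiableWithinAt
    · intro s hs
      rw [(hd s (interior_subset hs)).deriv]
      have h1 := hQbound s (interior_subset hs)
      have h2 : Real.exp (lam * (s - a)) * (lam * (Q s - C) + Q' s) ≤ 0 := by
        apply mul_nonpos_of_nonneg_of_nonpos (Real.exp_nonneg _)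
        linarith
      linarith
  have h1 := hanti ⟨le_rfl, hab⟩ ⟨hab, le_rfl⟩ hab
  simp only [sub_self, mul_zero, Real.exp_zero, one_mul] at h1
  have h2 : Q a ≤ 4 * r ^ 2 := by
    have := coneForm_le_norm_sq θ ℓ (D a)
    have h3 : ‖D a‖ ≤ 2 * r := hdist a ⟨le_rfl, hab⟩
    have h4 := norm_nonneg (D a)
    simp only [hQ]
    nlinarith
  have hCnn : 0 ≤ C := by rw [hC]; positivity
  have h3 : Q b - C ≤ Real.exp (-lam * (b - a)) * (4 * r ^ 2) := by
    have h4 : Real.exp (-lam * (b - a)) * (Real.exp (lam * (b - a)) * (Q b - C)) = Q b - C := by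
      rw [← mul_assoc, ← Real.exp_add]
      simp
    rw [← h4]
    apply mul_le_mul_of_nonneg_left _ (Real.exp_nonneg _)
    linarith
  change Q b ≤ _
  linarith

end Flow

/-- Continuity in time, uniformly on compact sets in space. -/
lemma exists_time_uniform {E F : Type*} [SeminormedAddCommGroup E] [SeminormedAddCommGroup F]
    {T : ℝ} {G : ℝ × E → F} (hG : ContinuousOn G (Icc 0 T ×ˢ univ))
    {K : Set E} (hK : IsCompact K) {τ : ℝ} (hτ : τ ∈ Icc 0 T) {e : ℝ} (he : 0 < e) :
    ∃ η > 0, ∀ t ∈ Icc 0 T, |t - τ| ≤ η → ∀ z ∈ K, ‖G (t, z) - G (τ, z)‖ ≤ e := by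
  have h1 := (isCompact_Icc.prod hK).uniformContinuousOn_of_continuous
    (hG.mono (prod_mono_right (subset_univ K)))
  obtain ⟨δ, hδ, h2⟩ := Metric.uniformContinuousOn_iff.1 h1 e he
  refine ⟨δ / 2, by positivity, fun t ht htτ z hz => ?_⟩
  have h3 := h2 (t, z) ⟨ht, hz⟩ (τ, z) ⟨hτ, hz⟩ (by
    rw [Prod.dist_eq, dist_self, max_eq_left dist_nonneg, Real.dist_eq]; linarith)
  rw [dist_eq_norm] at h3
  exact h3.le

section Slice

variable {E F : Type*} [NormedAddCommGroup E] [NormedSpace ℝ E]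
  [NormedAddCommGroup F] [NormedSpace ℝ F]

lemma uniqueDiffOn_Icc_prod_univ {T : ℝ} (hT : 0 < T) :
    UniqueDiffOn ℝ (Icc 0 T ×ˢ (univ : Set E)) :=
  (uniqueDiffOn_Icc hT).prod uniqueDiffOn_univ

lemma hasFDerivAt_slice {T : ℝ} {G : ℝ × E → F}
    (hG : DifferentiableOn ℝ G (Icc 0 T ×ˢ univ)) {t : ℝ} (ht : t ∈ Icc 0 T) (z : E) :
    HasFDerivAt (fun z => G (t, z))
      ((fderivWithin ℝ G (Icc 0 T ×ˢ univ) (t, z)).comp (ContinuousLinearMap.inr ℝ ℝ E)) z := by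
  have h1 := (hG (t, z) ⟨ht, mem_univ _⟩).hasFDerivWithinAt
  have h2 : HasFDerivWithinAt (fun z : E => (t, z)) (ContinuousLinearMap.inr ℝ ℝ E) univ z :=
    (hasFDerivAt_prodMk_right t z).hasFDerivWithinAt
  have h3 := h1.comp z h2 (fun z _ => ⟨ht, mem_univ _⟩)
  exact hasFDerivWithinAt_univ.1 h3

lemma contDiffOn_fderiv_slice {T : ℝ} (hT : 0 < T) {G : ℝ × E → F} {m n : WithTop ℕ∞}
    (hG : ContDiffOn ℝ n G (Icc 0 T ×ˢ univ)) (hmn : m + 1 ≤ n) :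
    ContDiffOn ℝ m (fun p : ℝ × E => fderiv ℝ (fun z => G (p.1, z)) p.2) (Icc 0 T ×ˢ univ) := by
  have hd : DifferentiableOn ℝ G (Icc 0 T ×ˢ univ) := hG.differentiableOn (by
    rintro rfl
    simp at hmn)
  have h1 := hG.fderivWithin (uniqueDiffOn_Icc_prod_univ hT) hmn
  have h2 : ContDiffOn ℝ m (fun p : ℝ × E => (fderivWithin ℝ G (Icc 0 T ×ˢ univ) p).comp
      (ContinuousLinearMap.inr ℝ ℝ E)) (Icc 0 T ×ˢ univ) :=
    h1.clm_comp contDiffOn_const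
  refine h2.congr ?_
  rintro ⟨t, z⟩ hp
  exact (hasFDerivAt_slice hd hp.1 z).fderiv

lemma contDiff_slice {T : ℝ} {G : ℝ × E → F} {n : WithTop ℕ∞}
    (hG : ContDiffOn ℝ n G (Icc 0 T ×ˢ univ)) {t : ℝ} (ht : t ∈ Icc 0 T) :
    ContDiff ℝ n (fun z => G (t, z)) := by
  rw [← contDiffOn_univ]
  exact hG.comp (contDiff_prodMk_right t).contDiffOn (fun z _ => ⟨ht, mem_univ _⟩)

lemma contDiffAt_of_mem_Ioo {T : ℝ} {G : ℝ × E → F} {n : WithTop ℕ∞}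
    (hG : ContDiffOn ℝ n G (Icc 0 T ×ˢ univ)) {t : ℝ} (ht : t ∈ Ioo 0 T) (z : E) :
    ContDiffAt ℝ n G (t, z) :=
  hG.contDiffAt (prod_mem_nhds (Icc_mem_nhds ht.1 ht.2) univ_mem)

end Slice

section Monotone

variable {E : Type*} [NormedAddCommGroup E] [InnerProductSpace ℝ E] [FiniteDimensional ℝ E]

/-- Along a curve of points with positive definite derivative, `g` is uniformly strongly monotone
in a tube. -/
lemma exists_strong_monotone_tube {T p q : ℝ} (hT : 0 < T) {g : ℝ → E → E}
    (hg : ContDiffOn ℝ 1 (fun p : ℝ × E => g p.1 p.2) (Icc 0 T ×ˢ univ))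
    {c : ℝ → E} (hc : ContinuousOn c (Icc p q)) (hpq : Icc p q ⊆ Icc 0 T)
    (hpos : ∀ t ∈ Icc p q, ∀ y : E, y ≠ 0 → 0 < ⟪fderiv ℝ (g t) (c t) y, y⟫) :
    ∃ μ > 0, ∃ ρ > 0, ∀ t ∈ Icc p q, ∀ z, ‖z - c t‖ ≤ ρ →
      μ * ‖z - c t‖ ^ 2 ≤ ⟪z - c t, g t z - g t (c t)⟫ := by
  have hH := (contDiffOn_fderiv_slice (m := 0) hT hg (by norm_num)).continuousOn
  have hd := hg.differentiableOn (by norm_num)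
  set H : ℝ × E → E →L[ℝ] E := fun p => fderiv ℝ (fun z => g p.1 z) p.2 with hHdef
  have hder : ∀ t ∈ Icc 0 T, ∀ z, HasFDerivAt (g t) (H (t, z)) z := fun t ht z =>
    (hasFDerivAt_slice hd ht z).differentiableAt.hasFDerivAt
  have hHc : ContinuousOn (fun t => H (t, c t)) (Icc p q) :=
    hH.comp (continuousOn_id.prodMk hc) (fun t ht => ⟨hpq ht, mem_univ _⟩)
  obtain ⟨μ, hμ, hμle⟩ : ∃ μ > 0, ∀ t ∈ Icc p q, ∀ y ∈ Metric.sphere (0 : E) 1,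
      2 * μ ≤ ⟪H (t, c t) y, y⟫ := by
    rcases (Icc p q ×ˢ Metric.sphere (0 : E) 1).eq_empty_or_nonempty with h | h
    · refine ⟨1, one_pos, fun t ht y hy => ?_⟩
      have : (t, y) ∈ Icc p q ×ˢ Metric.sphere (0 : E) 1 := ⟨ht, hy⟩
      rw [h] at this
      exact this.elim
    · have hcont : ContinuousOn (fun r : ℝ × E => ⟪H (r.1, c r.1) r.2, r.2⟫)
          (Icc p q ×ˢ Metric.sphere (0 : E) 1) := by
        have h1 : ContinuousOn (fun r : ℝ × E => H (r.1, c r.1))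
            (Icc p q ×ˢ Metric.sphere (0 : E) 1) :=
          hHc.comp continuousOn_fst (fun r hr => hr.1)
        exact (h1.clm_apply continuousOn_snd).inner continuousOn_snd
      obtain ⟨⟨t₁, y₁⟩, h1, h2⟩ :=
        (isCompact_Icc.prod (isCompact_sphere (0 : E) 1)).exists_isMinOn h hcont
      have hy₁ : y₁ ≠ 0 := by
        have := h1.2
        rw [mem_sphere_zero_iff_norm] at this
        rintro rfl
        simp at this
      refine ⟨⟪H (t₁, c t₁) y₁, y₁⟫ / 2, half_pos (hpos t₁ h1.1 y₁ hy₁), fun t ht y hy => ?_⟩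
      have := h2 (show (t, y) ∈ Icc p q ×ˢ Metric.sphere (0 : E) 1 from ⟨ht, hy⟩)
      simp only [mem_ofPred_eq] at this
      linarith
  have hμ' : ∀ t ∈ Icc p q, ∀ y : E, 2 * μ * ‖y‖ ^ 2 ≤ ⟪H (t, c t) y, y⟫ := by
    intro t ht y
    rcases eq_or_ne y 0 with rfl | hy
    · simp
    have hn : ‖y‖ ≠ 0 := norm_ne_zero_iff.2 hy
    have h1 := hμle t ht (‖y‖⁻¹ • y) (by simp [norm_smul, hn])
    rw [map_smul, inner_smul_left, inner_smul_right] at h1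
    have h2 := mul_le_mul_of_nonneg_right h1 (sq_nonneg ‖y‖)
    refine h2.trans_eq ?_
    simp
    field_simp
  obtain ⟨ρ, hρ, hρ1⟩ : ∃ ρ > 0, ∀ t ∈ Icc p q, ∀ y, ‖y‖ ≤ ρ →
      ‖H (t, c t + y) - H (t, c t)‖ ≤ μ := by
    have hc2 : ContinuousOn (fun r : ℝ × E => H (r.1, c r.1 + r.2))
        (Icc p q ×ˢ Metric.closedBall (0 : E) 1) := by
      refine hH.comp (continuousOn_fst.prodMk
        ((hc.comp continuousOn_fst fun r hr => hr.1).add continuousOn_snd)) ?_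
      exact fun r hr => ⟨hpq hr.1, mem_univ _⟩
    have h1 := (isCompact_Icc.prod
      (isCompact_closedBall (0 : E) 1)).uniformContinuousOn_of_continuous hc2
    obtain ⟨δ, hδ, h2⟩ := Metric.uniformContinuousOn_iff.1 h1 μ hμ
    refine ⟨min (δ / 2) 1, by positivity, fun t ht y hy => ?_⟩
    have hy1 : ‖y‖ ≤ 1 := hy.trans (min_le_right _ _)
    have hy2 : ‖y‖ ≤ δ / 2 := hy.trans (min_le_left _ _)
    have h3 := h2 (t, y) ⟨ht, by simpa using hy1⟩ (t, 0) ⟨ht, by simp⟩ (by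
      rw [Prod.dist_eq, dist_self, max_eq_right dist_nonneg, dist_zero_right]; linarith)
    rw [dist_eq_norm] at h3
    simpa using h3.le
  refine ⟨μ, hμ, ρ, hρ, fun t ht z hz => ?_⟩
  set y := z - c t with hy
  have hline : ∀ s : ℝ, HasDerivAt (fun s : ℝ => ⟪y, g t (c t + s • y)⟫)
      ⟪y, H (t, c t + s • y) y⟫ s := by
    intro s
    have h1 : HasDerivAt (fun s : ℝ => c t + s • y) y s := by
      simpa using ((hasDerivAt_id s).smul_const y).const_add (c t)
    have h2 := (hder t (hpq ht) (c t + s • y)).comp_hasDerivAt s h1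
    have h3 := (hasDerivAt_const s y).inner ℝ h2
    simpa using h3
  obtain ⟨s, hs, hs'⟩ := exists_deriv_eq_slope (fun s : ℝ => ⟪y, g t (c t + s • y)⟫) one_pos
    (fun s _ => (hline s).continuousAt.continuousWithinAt)
    (fun s _ => (hline s).differentiableAt.differentiableWithinAt)
  rw [(hline s).deriv] at hs'
  have hz' : c t + y = z := by simp [hy]
  simp only [one_smul, zero_smul, add_zero, sub_zero, div_one, hz'] at hs'
  rw [inner_sub_right, ← hs']
  have hsy : ‖s • y‖ ≤ ρ := by
    rw [norm_smul, Real.norm_of_nonneg hs.1.le]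
    nlinarith [hs.2.le, norm_nonneg y]
  have h1 := hρ1 t ht (s • y) hsy
  have h2 := hμ' t ht y
  have h3 : |⟪y, (H (t, c t + s • y) - H (t, c t)) y⟫| ≤ μ * ‖y‖ ^ 2 := by
    refine (abs_real_inner_le_norm _ _).trans ?_
    have := (H (t, c t + s • y) - H (t, c t)).le_of_opNorm_le h1 y
    nlinarith [norm_nonneg y]
  have h4 : ⟪y, H (t, c t + s • y) y⟫ =
      ⟪H (t, c t) y, y⟫ + ⟪y, (H (t, c t + s • y) - H (t, c t)) y⟫ := by
    rw [sub_apply, inner_sub_right y (H (t, c t + s • y) y), real_inner_comm (H (t, c t) y)]; ring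
  rw [h4]
  linarith [neg_abs_le (⟪y, (H (t, c t + s • y) - H (t, c t)) y⟫)]

end Monotone

section Gradient

variable {E : Type*} [NormedAddCommGroup E] [InnerProductSpace ℝ E] [CompleteSpace E]

lemma inner_gradient_eq_fderiv (F : E → ℝ) (z y : E) : ⟪gradient F z, y⟫ = fderiv ℝ F z y :=
  InnerProductSpace.toDual_symm_apply

lemma contDiffOn_gradient_slice {T : ℝ} (hT : 0 < T) {f : ℝ → E → ℝ}
    (hf : ContDiffOn ℝ 3 (Function.uncurry f) (Icc 0 T ×ˢ univ)) :
    ContDiffOn ℝ 2 (fun p : ℝ × E => gradient (f p.1) p.2) (Icc 0 T ×ˢ univ) :=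
  (LinearIsometryEquiv.contDiff
    ((InnerProductSpace.toDual ℝ E).symm : StrongDual ℝ E ≃ₗᵢ[ℝ] E)).comp_contDiffOn
    (contDiffOn_fderiv_slice (m := 2) hT hf (by norm_num))

lemma inner_fderiv_gradient {F : E → ℝ} (hF : ContDiff ℝ 2 F) (z y w : E) :
    ⟪fderiv ℝ (gradient F) z y, w⟫ = fderiv ℝ (fderiv ℝ F) z y w := by
  have h1 : HasFDerivAt (fderiv ℝ F) (fderiv ℝ (fderiv ℝ F) z) z :=
    ((hF.fderiv_right (m := 1) (by norm_num)).differentiable (by norm_num) z).hasFDerivAt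
  have h2 := (((InnerProductSpace.toDual ℝ E).symm :
    StrongDual ℝ E ≃ₗᵢ[ℝ] E).toContinuousLinearEquiv.hasFDerivAt).comp z h1
  have h3 : HasFDerivAt (gradient F) _ z := h2
  rw [h3.fderiv]
  exact InnerProductSpace.toDual_symm_apply

lemma inner_fderiv_gradient_comm {F : E → ℝ} (hF : ContDiff ℝ 2 F) (z y w : E) :
    ⟪fderiv ℝ (gradient F) z y, w⟫ = ⟪fderiv ℝ (gradient F) z w, y⟫ := by
  rw [inner_fderiv_gradient hF, inner_fderiv_gradient hF]
  exact (hF.contDiffAt.isSymmSndFDerivAt (by simp)).eq y w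

lemma fderiv_fderiv_inner_gradient {F : E → ℝ} (hF : ContDiff ℝ 3 F) (z ℓ : E) :
    fderiv ℝ (fderiv ℝ (fun z => ⟪gradient F z, ℓ⟫)) z ℓ ℓ =
      iteratedFDeriv ℝ 3 F z ![ℓ, ℓ, ℓ] := by
  have hF1 : ContDiff ℝ 2 (fderiv ℝ F) := hF.fderiv_right (by norm_num)
  have hF2 : ContDiff ℝ 1 (fderiv ℝ (fderiv ℝ F)) := hF1.fderiv_right (by norm_num)
  have e1 : (fun z => ⟪gradient F z, ℓ⟫) = fun z => fderiv ℝ F z ℓ :=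
    funext fun z => inner_gradient_eq_fderiv F z ℓ
  have e2 : ∀ z, fderiv ℝ (fun z => fderiv ℝ F z ℓ) z =
      (ContinuousLinearMap.apply ℝ ℝ ℓ).comp (fderiv ℝ (fderiv ℝ F) z) := fun z =>
    ((ContinuousLinearMap.apply ℝ ℝ ℓ).hasFDerivAt.comp z
      (hF1.differentiable (by norm_num) z).hasFDerivAt).fderiv
  have hd : DifferentiableAt ℝ (fun z => fderiv ℝ (fun z => fderiv ℝ F z ℓ) z) z := by
    have : ContDiff ℝ 1 (fun z => fderiv ℝ (fun z => fderiv ℝ F z ℓ) z) :=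
      ContDiff.fderiv_right (n := 2) (hF1.clm_apply contDiff_const) (by norm_num)
    exact this.differentiable (by norm_num) z
  have e3 : fderiv ℝ (fun z => fderiv ℝ (fun z => fderiv ℝ F z ℓ) z ℓ) z ℓ =
      fderiv ℝ (fderiv ℝ (fun z => fderiv ℝ F z ℓ)) z ℓ ℓ := by
    have := (ContinuousLinearMap.apply ℝ ℝ ℓ).hasFDerivAt.comp z hd.hasFDerivAt
    have h2 : HasFDerivAt (fun z => fderiv ℝ (fun z => fderiv ℝ F z ℓ) z ℓ) _ z := this
    rw [h2.fderiv]
    rfl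
  have hd3 : DifferentiableAt ℝ (iteratedFDeriv ℝ 2 F) z :=
    (hF.differentiable_iteratedFDeriv (m := 2) (by norm_num)) z
  have e4 : fderiv ℝ (fun z => iteratedFDeriv ℝ 2 F z ![ℓ, ℓ]) z ℓ =
      fderiv ℝ (iteratedFDeriv ℝ 2 F) z ℓ ![ℓ, ℓ] := by
    have := (ContinuousMultilinearMap.apply ℝ (fun _ : Fin 2 => E) ℝ ![ℓ, ℓ]).hasFDerivAt.comp z
      hd3.hasFDerivAt
    have h2 : HasFDerivAt (fun z => iteratedFDeriv ℝ 2 F z ![ℓ, ℓ]) _ z := this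
    rw [h2.fderiv]
    rfl
  rw [e1, ← e3, iteratedFDeriv_succ_apply_left]
  have e5 : Fin.tail ![ℓ, ℓ, ℓ] = ![ℓ, ℓ] := rfl
  have e6 : (![ℓ, ℓ, ℓ] : Fin 3 → E) 0 = ℓ := rfl
  rw [e5, e6, ← e4]
  congr 2
  funext z
  rw [iteratedFDeriv_two_apply, e2]
  rfl

lemma hasDerivAt_inner_gradient {T : ℝ} {f : ℝ → E → ℝ}
    (hf : ContDiffOn ℝ 3 (Function.uncurry f) (Icc 0 T ×ˢ univ)) {t : ℝ} (ht : t ∈ Ioo 0 T)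
    (z ℓ : E) :
    HasDerivAt (fun s => ⟪gradient (f s) z, ℓ⟫)
      ⟪gradient (fun z => deriv (fun s => f s z) t) z, ℓ⟫ t := by
  set Φ : ℝ × E → ℝ := Function.uncurry f with hΦ
  have hΦ3 : ∀ s ∈ Ioo 0 T, ∀ z, ContDiffAt ℝ 3 Φ (s, z) := fun s hs z =>
    contDiffAt_of_mem_Ioo hf hs z
  have hΦd : ∀ s ∈ Ioo 0 T, ∀ z, HasFDerivAt Φ (fderiv ℝ Φ (s, z)) (s, z) := fun s hs z =>
    ((hΦ3 s hs z).differentiableAt (by norm_num)).hasFDerivAt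
  have hΦdd : HasFDerivAt (fderiv ℝ Φ) (fderiv ℝ (fderiv ℝ Φ) (t, z)) (t, z) :=
    (((hΦ3 t ht z).fderiv_right (m := 2) (by norm_num)).differentiableAt (by norm_num)).hasFDerivAt
  have hsymm := (((hΦ3 t ht z).of_le (m := 2) (by norm_num)).isSymmSndFDerivAt (by simp)).eq
    ((1 : ℝ), (0 : E)) ((0 : ℝ), ℓ)
  have e1 : ∀ s ∈ Ioo 0 T, ⟪gradient (f s) z, ℓ⟫ = fderiv ℝ Φ (s, z) (0, ℓ) := by
    intro s hs
    rw [inner_gradient_eq_fderiv]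
    have h1 : HasFDerivAt (fun z => Φ (s, z)) _ z :=
      (hΦd s hs z).comp z (hasFDerivAt_prodMk_right s z)
    have h2 : HasFDerivAt (f s) _ z := h1
    rw [h2.fderiv]
    simp
  have e2 : ∀ z, deriv (fun s => f s z) t = fderiv ℝ Φ (t, z) (1, 0) := by
    intro z
    have h1 : HasFDerivAt (fun s => Φ (s, z)) _ t :=
      HasFDerivAt.comp (g := Φ) (f := fun s => (s, z)) t (hΦd t ht z)
        (hasFDerivAt_prodMk_left (𝕜 := ℝ) t z)
    have h2 : HasFDerivAt (fun s => f s z) _ t := h1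
    rw [h2.hasDerivAt.deriv]
    simp
  have e3 : ⟪gradient (fun z => deriv (fun s => f s z) t) z, ℓ⟫ =
      fderiv ℝ (fderiv ℝ Φ) (t, z) (0, ℓ) (1, 0) := by
    rw [inner_gradient_eq_fderiv, funext e2]
    have h1 := (ContinuousLinearMap.apply ℝ ℝ ((1 : ℝ), (0 : E))).hasFDerivAt.comp z
      (hΦdd.comp z (hasFDerivAt_prodMk_right t z))
    have h2 : HasFDerivAt (fun z => fderiv ℝ Φ (t, z) (1, 0)) _ z := h1
    rw [h2.fderiv]
    simp
  rw [e3, ← hsymm]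
  have h1 := (ContinuousLinearMap.apply ℝ ℝ ((0 : ℝ), ℓ)).hasFDerivAt.comp t
      (hΦdd.comp t (hasFDerivAt_prodMk_left t z))
  have h2 : HasFDerivAt (fun s => fderiv ℝ Φ (s, z) (0, ℓ)) _ t := h1
  have h3 := h2.hasDerivAt
  refine (h3.congr_of_eventuallyEq ?_).congr_deriv (by simp)
  filter_upwards [Ioo_mem_nhds ht.1 ht.2] with s hs using e1 s hs

end Gradient

section Fold

variable {E : Type*} [NormedAddCommGroup E] [InnerProductSpace ℝ E]

lemma norm_sub_inner_smul_sq {ℓ : E} (hℓ : ‖ℓ‖ = 1) (D : E) :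
    ‖D - ⟪D, ℓ⟫ • ℓ‖ ^ 2 = ‖D‖ ^ 2 - ⟪D, ℓ⟫ ^ 2 := by
  rw [norm_sub_sq_real, inner_smul_right, norm_smul, hℓ, mul_one, Real.norm_eq_abs, sq_abs]
  ring

/-- A symmetric positive semidefinite operator whose kernel is a line is coercive transversally to
that line. -/
lemma exists_transversal_gap [FiniteDimensional ℝ E] {A : E →L[ℝ] E} {ℓ : E} (hℓ : ‖ℓ‖ = 1)
    (hsymm : ∀ y w, ⟪A y, w⟫ = ⟪A w, y⟫) (hpsd : ∀ y, 0 ≤ ⟪A y, y⟫) (hAℓ : A ℓ = 0)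
    (hker : ∀ y, A y = 0 → ∃ c : ℝ, y = c • ℓ) :
    ∃ lam > 0, ∀ D, lam * (‖D‖ ^ 2 - ⟪D, ℓ⟫ ^ 2) ≤ ⟪A D, D⟫ := by
  have hzero : ∀ y, ⟪A y, y⟫ = 0 → A y = 0 := by
    intro y hy
    by_contra hne
    have hpos : 0 < ⟪A y, A y⟫ := real_inner_self_pos.2 hne
    set N := ⟪A y, A y⟫ with hN
    set M := ⟪A (A y), A y⟫ with hM
    have hM0 : 0 ≤ M := hpsd _
    have h1 : ∀ s : ℝ, 0 ≤ 2 * s * N + s ^ 2 * M := by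
      intro s
      have h2 := hpsd (y + s • A y)
      rw [map_add, map_smul, inner_add_left, inner_add_right, inner_add_right, inner_smul_left,
        inner_smul_left, inner_smul_right, inner_smul_right, hy, hsymm (A y) y] at h2
      simp only [conj_trivial] at h2
      rw [← hN, ← hM] at h2
      linarith
    have h3 := h1 (-(N / (M + 1)))
    have hlt : 2 * -(N / (M + 1)) * N + (-(N / (M + 1))) ^ 2 * M < 0 := by
      have : 2 * -(N / (M + 1)) * N + (-(N / (M + 1))) ^ 2 * M =
          - (N ^ 2 * (M + 2)) / (M + 1) ^ 2 := by field_simp; ring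
      rw [this]
      apply div_neg_of_neg_of_pos <;> [skip; positivity]
      have : 0 < N ^ 2 * (M + 2) := by positivity
      linarith
    linarith
  obtain ⟨lam, hlam, hle⟩ : ∃ lam > 0, ∀ y ∈ Metric.sphere (0 : E) 1 ∩ {y | ⟪y, ℓ⟫ = 0},
      lam ≤ ⟪A y, y⟫ := by
    rcases (Metric.sphere (0 : E) 1 ∩ {y | ⟪y, ℓ⟫ = 0}).eq_empty_or_nonempty with h | h
    · exact ⟨1, one_pos, fun y hy => by rw [h] at hy; exact hy.elim⟩
    · have hcl : IsClosed {y : E | ⟪y, ℓ⟫ = 0} :=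
        isClosed_eq (by fun_prop) continuous_const
      obtain ⟨y, hy, hmin⟩ := ((isCompact_sphere (0 : E) 1).inter_right hcl).exists_isMinOn h
        (f := fun y => ⟪A y, y⟫) (by fun_prop)
      refine ⟨⟪A y, y⟫, lt_of_le_of_ne (hpsd y) fun h0 => ?_, fun z hz => hmin hz⟩
      obtain ⟨c, hc⟩ := hker y (hzero y h0.symm)
      have h1 : ⟪y, ℓ⟫ = 0 := hy.2
      have h2 : ‖y‖ = 1 := mem_sphere_zero_iff_norm.1 hy.1
      rw [hc, inner_smul_left, real_inner_self_eq_norm_sq, hℓ] at h1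
      simp at h1
      rw [hc, h1] at h2
      simp at h2
  refine ⟨lam, hlam, fun D => ?_⟩
  set b := D - ⟪D, ℓ⟫ • ℓ with hb
  rw [← norm_sub_inner_smul_sq hℓ, ← hb]
  have h1 : ⟪A D, D⟫ = ⟪A b, b⟫ := by
    have hAb : A b = A D := by simp [hb, hAℓ]
    rw [hAb, hb, inner_sub_right, inner_smul_right, hsymm D ℓ, hAℓ]
    simp
  rw [h1]
  rcases eq_or_ne b 0 with h0 | h0
  · simp [h0]
  have hn : ‖b‖ ≠ 0 := norm_ne_zero_iff.2 h0
  have h2 := hle (‖b‖⁻¹ • b) ⟨by simp [norm_smul, hn], by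
    have : ⟪b, ℓ⟫ = 0 := by
      rw [hb, inner_sub_left, inner_smul_left, real_inner_self_eq_norm_sq, hℓ]; simp
    change ⟪‖b‖⁻¹ • b, ℓ⟫ = 0
    rw [inner_smul_left, this, mul_zero]⟩
  rw [map_smul, inner_smul_left, inner_smul_right] at h2
  have h3 := mul_le_mul_of_nonneg_right h2 (sq_nonneg ‖b‖)
  refine h3.trans_eq ?_
  simp
  field_simp

/-- Second order Taylor expansion at a critical point. -/
lemma exists_abs_sub_half_sndFDeriv_le {h : E → ℝ} (hh : ContDiff ℝ 2 h) {x₀ : E} (h0 : h x₀ = 0)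
    (h1 : fderiv ℝ h x₀ = 0) {η : ℝ} (hη : 0 < η) :
    ∃ r > 0, ∀ z, ‖z - x₀‖ ≤ r →
      |h z - fderiv ℝ (fderiv ℝ h) x₀ (z - x₀) (z - x₀) / 2| ≤ η * ‖z - x₀‖ ^ 2 := by
  have hd : ∀ z, HasFDerivAt h (fderiv ℝ h z) z := fun z =>
    (hh.differentiable (by norm_num) z).hasFDerivAt
  have hd2 : HasFDerivAt (fderiv ℝ h) (fderiv ℝ (fderiv ℝ h) x₀) x₀ :=
    ((hh.fderiv_right (m := 1) (by norm_num)).differentiable (by norm_num) x₀).hasFDerivAt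
  have hlo := hd2.isLittleO.bound hη
  obtain ⟨r, hr, hball⟩ := Metric.eventually_nhds_iff_ball.1 hlo
  refine ⟨r / 2, by positivity, fun z hz => ?_⟩
  set D := z - x₀ with hD
  set B := fderiv ℝ (fderiv ℝ h) x₀ with hB
  have hline : ∀ s : ℝ, HasDerivAt (fun s : ℝ => h (x₀ + s • D) - s ^ 2 * (B D D / 2))
      (fderiv ℝ h (x₀ + s • D) D - s * B D D) s := by
    intro s
    have e1 : HasDerivAt (fun s : ℝ => x₀ + s • D) D s := by
      simpa using ((hasDerivAt_id s).smul_const D).const_add x₀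
    have e2 := (hd (x₀ + s • D)).comp_hasDerivAt s e1
    have e3 := e2.sub ((hasDerivAt_pow 2 s).mul_const (B D D / 2))
    refine e3.congr_deriv ?_
    norm_num
    ring
  have key := norm_image_sub_le_of_norm_deriv_le_segment_01'
    (f := fun s : ℝ => h (x₀ + s • D) - s ^ 2 * (B D D / 2)) (C := η * ‖D‖ ^ 2)
    (fun s _ => (hline s).hasDerivWithinAt) (by
      intro s hs
      have hsn : ‖s • D‖ ≤ ‖D‖ := by
        rw [norm_smul, Real.norm_of_nonneg hs.1]
        exact mul_le_of_le_one_left (norm_nonneg _) hs.2.le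
      have e1 := hball (x₀ + s • D) (by
        rw [mem_ball_iff_norm, add_sub_cancel_left]
        linarith)
      rw [h1, sub_zero, add_sub_cancel_left] at e1
      have e2 := (fderiv ℝ h (x₀ + s • D) - B (s • D)).le_of_opNorm_le e1 D
      have e3 : (fderiv ℝ h (x₀ + s • D) - B (s • D)) D =
          fderiv ℝ h (x₀ + s • D) D - s * B D D := by
        simp
      rw [e3] at e2
      refine e2.trans ?_
      have := mul_le_mul_of_nonneg_right hsn (norm_nonneg D)
      nlinarith)
  have hz' : x₀ + D = z := by simp [hD]
  simp only [one_smul, zero_smul, add_zero, h0, hz'] at key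
  rw [Real.norm_eq_abs] at key
  refine le_trans (le_of_eq ?_) key
  congr 1
  ring

/-- The value of a bounded bilinear form on a vector close to the line spanned by `ℓ`. -/
lemma abs_bilin_sub_le (B : E →L[ℝ] E →L[ℝ] ℝ) {ℓ : E} (hℓ : ‖ℓ‖ = 1) (D : E) :
    |B D D - ⟪D, ℓ⟫ ^ 2 * B ℓ ℓ| ≤
      ‖B‖ * (2 * |⟪D, ℓ⟫| * ‖D - ⟪D, ℓ⟫ • ℓ‖ + ‖D - ⟪D, ℓ⟫ • ℓ‖ ^ 2) := by
  set α := ⟪D, ℓ⟫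
  set b := D - α • ℓ with hb
  have hD : D = α • ℓ + b := by simp [hb]
  have e : B D D - α ^ 2 * B ℓ ℓ = α * B ℓ b + α * B b ℓ + B b b := by
    conv_lhs => rw [hD]
    simp
    ring
  rw [e]
  have h1 : |B ℓ b| ≤ ‖B‖ * ‖b‖ := by
    have := B.le_opNorm₂ ℓ b; rwa [hℓ, mul_one] at this
  have h2 : |B b ℓ| ≤ ‖B‖ * ‖b‖ := by
    have := B.le_opNorm₂ b ℓ; rwa [hℓ, mul_one] at this
  have h3 : |B b b| ≤ ‖B‖ * ‖b‖ * ‖b‖ := B.le_opNorm₂ b b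
  calc _ ≤ |α * B ℓ b| + |α * B b ℓ| + |B b b| := abs_add_three _ _ _
    _ ≤ |α| * (‖B‖ * ‖b‖) + |α| * (‖B‖ * ‖b‖) + ‖B‖ * ‖b‖ * ‖b‖ := by
      rw [abs_mul, abs_mul]; gcongr
    _ = _ := by ring

/-- A transversal fold of the family `g t`, with kernel direction `ℓ` oriented so that the flow of
`-g τ` on the kernel line goes in the direction of `ℓ`. -/
structure IsFold (T : ℝ) (g : ℝ → E → E) (τ : ℝ) (x₀ ℓ : E) (A : E →L[ℝ] E)
    (lam κ₁ κ₃ : ℝ) : Prop where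
  contDiffOn : ContDiffOn ℝ 2 (fun p : ℝ × E => g p.1 p.2) (Icc 0 T ×ˢ univ)
  mem : τ ∈ Ioo 0 T
  crit : g τ x₀ = 0
  norm_eq : ‖ℓ‖ = 1
  hasFDerivAt : HasFDerivAt (g τ) A x₀
  orth : ∀ D, ⟪A D, ℓ⟫ = 0
  lam_pos : 0 < lam
  gap : ∀ D, lam * (‖D‖ ^ 2 - ⟪D, ℓ⟫ ^ 2) ≤ ⟪A D, D⟫
  hasDerivAt_time : HasDerivAt (fun s => ⟪g s x₀, ℓ⟫) κ₁ τ
  time_ne : κ₁ ≠ 0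
  quad : fderiv ℝ (fderiv ℝ (fun z => ⟪g τ z, ℓ⟫)) x₀ ℓ ℓ = -κ₃
  quad_pos : 0 < κ₃

namespace IsFold

variable {T : ℝ} {g : ℝ → E → E} {τ : ℝ} {x₀ ℓ : E} {A : E →L[ℝ] E} {lam κ₁ κ₃ : ℝ}

lemma contDiff_slice (hF : IsFold T g τ x₀ ℓ A lam κ₁ κ₃) : ContDiff ℝ 2 (g τ) :=
  _root_.contDiff_slice hF.contDiffOn (Ioo_subset_Icc_self hF.mem)

lemma contDiff_inner (hF : IsFold T g τ x₀ ℓ A lam κ₁ κ₃) :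
    ContDiff ℝ 2 (fun z => ⟪g τ z, ℓ⟫) :=
  hF.contDiff_slice.inner ℝ contDiff_const

lemma fderiv_inner (hF : IsFold T g τ x₀ ℓ A lam κ₁ κ₃) :
    fderiv ℝ (fun z => ⟪g τ z, ℓ⟫) x₀ = 0 := by
  have h1 := hF.hasFDerivAt.inner ℝ (hasFDerivAt_const ℓ x₀)
  rw [h1.fderiv]
  ext D
  simp [hF.orth]

/-- Expansion of the kernel component of `g τ`. -/
lemma exists_abs_inner_add_le (hF : IsFold T g τ x₀ ℓ A lam κ₁ κ₃) :
    ∃ K ≥ 0, ∀ η > 0, ∃ r > 0, ∀ z, ‖z - x₀‖ ≤ r →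
      |⟪g τ z, ℓ⟫ + κ₃ / 2 * ⟪z - x₀, ℓ⟫ ^ 2| ≤ η * ‖z - x₀‖ ^ 2 +
        K * (2 * |⟪z - x₀, ℓ⟫| * ‖z - x₀ - ⟪z - x₀, ℓ⟫ • ℓ‖ +
          ‖z - x₀ - ⟪z - x₀, ℓ⟫ • ℓ‖ ^ 2) := by
  set B := fderiv ℝ (fderiv ℝ (fun z => ⟪g τ z, ℓ⟫)) x₀ with hB
  refine ⟨‖B‖ / 2, by positivity, fun η hη => ?_⟩
  obtain ⟨r, hr, h⟩ := exists_abs_sub_half_sndFDeriv_le hF.contDiff_inner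
    (x₀ := x₀) (by simp [hF.crit]) hF.fderiv_inner hη
  refine ⟨r, hr, fun z hz => ?_⟩
  have h1 := h z hz
  rw [← hB] at h1
  have h2 := abs_bilin_sub_le B hF.norm_eq (z - x₀)
  rw [hB, hF.quad, ← hB] at h2
  have e : ⟪g τ z, ℓ⟫ + κ₃ / 2 * ⟪z - x₀, ℓ⟫ ^ 2 =
      (⟪g τ z, ℓ⟫ - B (z - x₀) (z - x₀) / 2) +
        (B (z - x₀) (z - x₀) - ⟪z - x₀, ℓ⟫ ^ 2 * -κ₃) / 2 := by ring
  rw [e]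
  refine (abs_add_le _ _).trans ?_
  rw [abs_div, abs_two]
  linarith

/-- On a thin cone around the kernel line the flow goes in the direction of `ℓ`. -/
lemma exists_cone_sign (hF : IsFold T g τ x₀ ℓ A lam κ₁ κ₃) :
    ∃ θ, 0 < θ ∧ θ ≤ 1 ∧ ∃ r > 0, ∃ c > 0, ∀ z, ‖z - x₀‖ ≤ r →
      ‖z - x₀‖ ^ 2 ≤ (1 + 4 * θ ^ 2) * ⟪z - x₀, ℓ⟫ ^ 2 →
      c * ⟪z - x₀, ℓ⟫ ^ 2 ≤ -⟪g τ z, ℓ⟫ := by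
  obtain ⟨K, hK, hη⟩ := hF.exists_abs_inner_add_le
  have hκ := hF.quad_pos
  obtain ⟨r, hr, h⟩ := hη (κ₃ / 40) (by positivity)
  set θ := min 1 (κ₃ / (64 * (K + 1))) with hθ
  have hθ0 : 0 < θ := by positivity
  have hθ1 : θ ≤ 1 := min_le_left _ _
  have hθ2 : θ * (64 * (K + 1)) ≤ κ₃ := by
    rw [← le_div_iff₀ (by positivity)]; exact min_le_right _ _
  refine ⟨θ, hθ0, hθ1, r, hr, κ₃ / 4, by positivity, fun z hz hcone => ?_⟩
  have h1 := h z hz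
  have h2 := norm_sub_inner_smul_sq hF.norm_eq (z - x₀)
  set α := ⟪z - x₀, ℓ⟫
  set b := ‖z - x₀ - α • ℓ‖
  have hb0 : 0 ≤ b := norm_nonneg _
  have hb : b ≤ 2 * θ * |α| := by
    apply le_of_sq_le_sq _ (by positivity)
    rw [mul_pow, mul_pow, sq_abs]; linarith
  have hθsq : θ ^ 2 ≤ θ := by nlinarith
  have h3 : 2 * |α| * b + b ^ 2 ≤ 8 * θ * α ^ 2 := by
    have t1 : |α| * b ≤ 2 * θ * α ^ 2 := by
      have := mul_le_mul_of_nonneg_left hb (abs_nonneg α)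
      rw [← sq_abs α]; linarith
    have t2 : b ^ 2 ≤ 4 * θ * α ^ 2 := by
      nlinarith [sq_nonneg α]
    linarith
  have h4 : K * (2 * |α| * b + b ^ 2) ≤ κ₃ / 8 * α ^ 2 := by
    refine (mul_le_mul_of_nonneg_left h3 hK).trans ?_
    have : K * (8 * θ) ≤ κ₃ / 8 := by nlinarith
    nlinarith [mul_le_mul_of_nonneg_right this (sq_nonneg α)]
  have h5 : ‖z - x₀‖ ^ 2 ≤ 5 * α ^ 2 := by
    nlinarith [sq_nonneg α]
  have h6 := (abs_le.1 h1).2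
  nlinarith

lemma exists_linear_approx (hF : IsFold T g τ x₀ ℓ A lam κ₁ κ₃) {κ : ℝ} (hκ : 0 < κ) :
    ∃ r > 0, ∀ z₁ ∈ Metric.closedBall x₀ r, ∀ z₂ ∈ Metric.closedBall x₀ r,
      ‖g τ z₁ - g τ z₂ - A (z₁ - z₂)‖ ≤ κ * ‖z₁ - z₂‖ := by
  have h1 := hF.contDiff_slice.contDiffAt.hasStrictFDerivAt (x := x₀) (by norm_num)
  rw [hF.hasFDerivAt.fderiv] at h1
  have h2 := h1.isLittleO.bound hκ
  obtain ⟨r, hr, h3⟩ := Metric.eventually_nhds_iff_ball.1 h2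
  refine ⟨r / 2, by positivity, fun z₁ h₁ z₂ h₂ => h3 (z₁, z₂) ?_⟩
  rw [Metric.mem_closedBall] at h₁ h₂
  rw [Metric.mem_ball, Prod.dist_eq]
  exact max_lt (by linarith) (by linarith)

set_option maxHeartbeats 2000000 in
/-- Near a fold the critical points lie close to a parabola. -/
lemma exists_critical_parabola (hF : IsFold T g τ x₀ ℓ A lam κ₁ κ₃) {η : ℝ} (hη : 0 < η) :
    ∃ r > 0, ∀ t, |t - τ| ≤ r → ∀ z, ‖z - x₀‖ ≤ r → g t z = 0 →
      |κ₁ * (t - τ) - κ₃ / 2 * ⟪z - x₀, ℓ⟫ ^ 2| ≤ η * (|t - τ| + ⟪z - x₀, ℓ⟫ ^ 2) := by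
  obtain ⟨K, hK, hKη⟩ := hF.exists_abs_inner_add_le
  have hlam := hF.lam_pos
  obtain ⟨r₁, hr₁, hquad⟩ := hKη (η / 8) (by positivity)
  have hG2 : ContDiffAt ℝ 2 (fun p : ℝ × E => g p.1 p.2) (τ, x₀) :=
    contDiffAt_of_mem_Ioo hF.contDiffOn hF.mem x₀
  have hGd := (hG2.differentiableAt (by norm_num)).hasFDerivAt
  set G' := fderiv ℝ (fun p : ℝ × E => g p.1 p.2) (τ, x₀) with hG'
  have hG'2 : ∀ D, G' (0, D) = A D := by
    intro D
    have h1 : HasFDerivAt (fun z => g τ z) _ x₀ := hGd.comp x₀ (hasFDerivAt_prodMk_right τ x₀)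
    rw [hF.hasFDerivAt.unique h1]
    simp
  have hG'1 : ⟪G' (1, 0), ℓ⟫ = κ₁ := by
    have h1 : HasFDerivAt (fun s => g s x₀) _ τ :=
      HasFDerivAt.comp (g := fun p : ℝ × E => g p.1 p.2) (f := fun s => (s, x₀)) τ hGd
        (hasFDerivAt_prodMk_left (𝕜 := ℝ) τ x₀)
    have h2 := h1.hasDerivAt.inner ℝ (hasDerivAt_const τ ℓ)
    have h3 := hF.hasDerivAt_time.unique h2
    rw [h3]
    simp
  have hG'eq : ∀ (s : ℝ) (D : E), G' (s, D) = s • G' (1, 0) + A D := by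
    intro s D
    rw [← hG'2, ← map_smul, ← map_add]
    simp
  set P := ‖G' (1, 0)‖ with hP
  have hP0 : 0 ≤ P := norm_nonneg _
  set ν := min 1 (η / (8 * (K + 1))) with hν
  have hν0 : 0 < ν := by positivity
  have hν1 : ν ≤ 1 := min_le_left _ _
  have hν2 : K * ν ≤ η / 8 := by
    have : ν * (8 * (K + 1)) ≤ η := by
      rw [← le_div_iff₀ (by positivity)]; exact min_le_right _ _
    nlinarith
  have hνη : ν ≤ η / 8 := by
    have : ν * (8 * (K + 1)) ≤ η := by
      rw [← le_div_iff₀ (by positivity)]; exact min_le_right _ _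
    nlinarith
  set η₁ := min 1 (lam * ν / 2) with hη₁
  have hη₁0 : 0 < η₁ := by positivity
  have hη₁1 : η₁ ≤ 1 := min_le_left _ _
  have hη₁2 : η₁ ≤ lam * ν / 2 := min_le_right _ _
  set C := 2 * (P + 1) / lam with hC
  have hC0 : 0 < C := by positivity
  have hClam : lam * C = 2 * (P + 1) := by rw [hC]; field_simp
  obtain ⟨r₂, hr₂, hfirst⟩ := Metric.eventually_nhds_iff_ball.1 (hGd.isLittleO.bound hη₁0)
  have hstrict := (hG2.hasStrictFDerivAt (by norm_num)).isLittleO.bound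
    (show 0 < η / 8 by positivity)
  obtain ⟨r₃, hr₃, htime⟩ := Metric.eventually_nhds_iff_ball.1 hstrict
  set r := min (min r₁ (min (r₂ / 2) (r₃ / 2))) (min (1 / C) (η / (8 * (K + 1) * C))) with hr
  have hr0 : 0 < r := by positivity
  have hrr₁ : r ≤ r₁ := (min_le_left _ _).trans (min_le_left _ _)
  have hrr₂ : r ≤ r₂ / 2 := (min_le_left _ _).trans ((min_le_right _ _).trans (min_le_left _ _))
  have hrr₃ : r ≤ r₃ / 2 := (min_le_left _ _).trans ((min_le_right _ _).trans (min_le_right _ _))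
  have hrC : r * C ≤ 1 := by
    rw [← le_div_iff₀ hC0]; exact (min_le_right _ _).trans (min_le_left _ _)
  have hrC2 : K * (r * C) ≤ η / 8 ∧ r * C ≤ η / 8 := by
    have : r * (8 * (K + 1) * C) ≤ η := by
      rw [← le_div_iff₀ (by positivity)]; exact (min_le_right _ _).trans (min_le_right _ _)
    have h1 : 0 < r * C := by positivity
    have h2 : 0 ≤ K * (r * C) := by positivity
    constructor <;> nlinarith
  refine ⟨r, hr0, fun t ht z hz hcrit => ?_⟩
  set s := t - τ with hs
  set D := z - x₀ with hD
  have hsplit := norm_sub_inner_smul_sq hF.norm_eq D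
  have hgap := hF.gap D
  set α := ⟪D, ℓ⟫ with hα
  set b := D - α • ℓ with hb
  have hαr : |α| ≤ r := by
    have := abs_real_inner_le_norm D ℓ
    rw [hF.norm_eq, mul_one] at this
    exact this.trans hz
  have hDα : ‖D‖ ≤ |α| + ‖b‖ := by
    have : D = α • ℓ + b := by simp [hb]
    calc ‖D‖ = ‖α • ℓ + b‖ := by rw [← this]
      _ ≤ _ := norm_add_le _ _
      _ = _ := by rw [norm_smul, hF.norm_eq, mul_one, Real.norm_eq_abs]
  have hbr : ‖b‖ ≤ r := by
    apply le_of_sq_le_sq _ hr0.le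
    have : ‖D‖ ^ 2 ≤ r ^ 2 := by gcongr
    nlinarith [sq_nonneg α]
  have hAD : ‖A D‖ ≤ P * |s| + η₁ * (|s| + ‖D‖) := by
    have h1 := hfirst (t, z) (by
      rw [Metric.mem_ball, Prod.dist_eq, dist_eq_norm, dist_eq_norm, Real.norm_eq_abs]
      exact max_lt (by linarith) (by linarith))
    simp only [hcrit, hF.crit, Prod.mk_sub_mk] at h1
    rw [← hs, ← hD, hG'eq, sub_zero, zero_sub, norm_neg, Prod.norm_mk, Real.norm_eq_abs] at h1
    have h2 : ‖A D‖ ≤ ‖s • G' (1, 0) + A D‖ + ‖s • G' (1, 0)‖ := by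
      calc ‖A D‖ = ‖(s • G' (1, 0) + A D) - s • G' (1, 0)‖ := by congr 1; abel
        _ ≤ _ := norm_sub_le _ _
    rw [norm_smul, Real.norm_eq_abs] at h2
    have h3 : max |s| ‖D‖ ≤ |s| + ‖D‖ :=
      max_le (by linarith [norm_nonneg D]) (by linarith [abs_nonneg s])
    have h4 := mul_le_mul_of_nonneg_left h3 hη₁0.le
    linarith
  have hlamb : lam * ‖b‖ ≤ ‖A D‖ := by
    rcases eq_or_lt_of_le (norm_nonneg b) with h0 | h0
    · rw [← h0, mul_zero]; exact norm_nonneg _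
    have h1 : ⟪A D, D⟫ = ⟪A D, b⟫ := by
      rw [hb, inner_sub_right (A D) D, inner_smul_right, hF.orth]; simp
    have h2 := real_inner_le_norm (A D) b
    rw [← hsplit, h1] at hgap
    have h3 : lam * ‖b‖ * ‖b‖ ≤ ‖A D‖ * ‖b‖ := by nlinarith
    exact le_of_mul_le_mul_right h3 h0
  have hbC : ‖b‖ ≤ C * |s| + ν * |α| := by
    have h1 : η₁ * (|s| + ‖D‖) ≤ |s| + lam * ν / 2 * |α| + lam / 2 * ‖b‖ := by
      have t1 : η₁ * |s| ≤ |s| := mul_le_of_le_one_left (abs_nonneg s) hη₁1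
      have t2 : η₁ * |α| ≤ lam * ν / 2 * |α| := mul_le_mul_of_nonneg_right hη₁2 (abs_nonneg α)
      have t3 : η₁ * ‖b‖ ≤ lam / 2 * ‖b‖ :=
        mul_le_mul_of_nonneg_right (by nlinarith) (norm_nonneg b)
      have t4 := mul_le_mul_of_nonneg_left hDα hη₁0.le
      linarith
    have h2 : lam * ‖b‖ ≤ lam * (C * |s| + ν * |α|) := by
      have : lam * (C * |s|) = 2 * (P + 1) * |s| := by rw [← mul_assoc, hClam]
      linarith
    exact le_of_mul_le_mul_left h2 hlam
  have hαb : |α| * ‖b‖ ≤ r * C * |s| + ν * α ^ 2 := by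
    have h1 := mul_le_mul_of_nonneg_left hbC (abs_nonneg α)
    have h2 : |α| * (C * |s|) ≤ r * (C * |s|) := mul_le_mul_of_nonneg_right hαr (by positivity)
    rw [← sq_abs α]
    linarith
  have hbb : ‖b‖ ^ 2 ≤ 2 * (r * C) * |s| + ν * α ^ 2 := by
    have h1 := mul_le_mul_of_nonneg_left hbC (norm_nonneg b)
    have h2 : ‖b‖ * (C * |s|) ≤ r * (C * |s|) := mul_le_mul_of_nonneg_right hbr (by positivity)
    have h3 : ν * (|α| * ‖b‖) ≤ |α| * ‖b‖ := mul_le_of_le_one_left (by positivity) hν1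
    nlinarith
  have hq := hquad z (hz.trans hrr₁)
  rw [← hD, ← hα, ← hb] at hq
  have ht1 : |⟪g τ z, ℓ⟫ + κ₁ * s| ≤ η / 8 * |s| := by
    have h1 := htime ((t, z), (τ, z)) (by
      rw [Metric.mem_ball, Prod.dist_eq, Prod.dist_eq, Prod.dist_eq, dist_self]
      simp only [dist_eq_norm, Real.norm_eq_abs]
      refine max_lt (max_lt ?_ ?_) (max_lt hr₃ ?_) <;> linarith)
    simp only [hcrit, Prod.mk_sub_mk] at h1
    rw [← hs, sub_self, ← hG', hG'eq, map_zero, add_zero, Prod.norm_mk, norm_zero,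
      max_eq_left (norm_nonneg _), Real.norm_eq_abs, zero_sub] at h1
    have h2 := abs_real_inner_le_norm (-g τ z - s • G' (1, 0)) ℓ
    rw [hF.norm_eq, mul_one, inner_sub_left, inner_neg_left, inner_smul_left, hG'1] at h2
    simp only [conj_trivial] at h2
    rw [← abs_neg]
    refine le_trans (le_of_eq ?_) (h2.trans h1)
    congr 1
    ring
  have hDsq : ‖D‖ ^ 2 = α ^ 2 + ‖b‖ ^ 2 := by linarith
  rw [hDsq] at hq
  have habs : |κ₁ * s - κ₃ / 2 * α ^ 2| ≤ η / 8 * |s| + (η / 8 * (α ^ 2 + ‖b‖ ^ 2) +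
      K * (2 * |α| * ‖b‖ + ‖b‖ ^ 2)) := by
    calc |κ₁ * s - κ₃ / 2 * α ^ 2|
        = |(⟪g τ z, ℓ⟫ + κ₁ * s) - (⟪g τ z, ℓ⟫ + κ₃ / 2 * α ^ 2)| := by congr 1; ring
      _ ≤ _ := abs_sub _ _
      _ ≤ _ := add_le_add ht1 hq
  refine habs.trans ?_
  have hs0 := abs_nonneg s
  have hα0 := sq_nonneg α
  have k1 : K * (2 * |α| * ‖b‖ + ‖b‖ ^ 2) ≤ K * (4 * (r * C) * |s| + 3 * ν * α ^ 2) := by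
    apply mul_le_mul_of_nonneg_left _ hK; linarith
  have k2 : K * (r * C) * |s| ≤ η / 8 * |s| := mul_le_mul_of_nonneg_right hrC2.1 hs0
  have k3 : K * ν * α ^ 2 ≤ η / 8 * α ^ 2 := mul_le_mul_of_nonneg_right hν2 hα0
  have k4 : η / 8 * ‖b‖ ^ 2 ≤ η / 8 * (2 * |s| + α ^ 2) := by
    apply mul_le_mul_of_nonneg_left _ (by positivity)
    have t1 : r * C * |s| ≤ |s| := mul_le_of_le_one_left hs0 hrC
    have t2 : ν * α ^ 2 ≤ α ^ 2 := mul_le_of_le_one_left hα0 hν1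
    linarith
  have k5 := mul_nonneg hη.le hs0
  have k6 := mul_nonneg hη.le hα0
  linarith

/-- If critical points accumulate at a fold from earlier times, then there are none at later
times. -/
lemma exists_no_critical (hF : IsFold T g τ x₀ ℓ A lam κ₁ κ₃)
    (hleft : ∀ r > 0, ∃ t < τ, |t - τ| ≤ r ∧ ∃ z, ‖z - x₀‖ ≤ r ∧ g t z = 0) :
    ∃ r > 0, ∀ t, τ < t → t ≤ τ + r → ∀ z, ‖z - x₀‖ ≤ r → g t z ≠ 0 := by
  have hκ := hF.quad_pos
  have hκ₁ := abs_pos.2 hF.time_ne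
  set η := min (|κ₁| / 2) (κ₃ / 4) with hη
  have hη0 : 0 < η := by positivity
  have hη1 : η ≤ |κ₁| / 2 := min_le_left _ _
  have hη2 : η ≤ κ₃ / 4 := min_le_right _ _
  obtain ⟨r, hr, h⟩ := hF.exists_critical_parabola hη0
  have key : ∀ s a : ℝ, κ₁ * s < 0 → |κ₁ * s - κ₃ / 2 * a ^ 2| ≤ η * (|s| + a ^ 2) → False := by
    intro s a hs hle
    have h1 : κ₁ * s = -(|κ₁| * |s|) := by rw [← abs_mul, abs_of_neg hs, neg_neg]
    have h2 := (abs_le.1 hle).1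
    have h3 : 0 < |κ₁| * |s| := by linarith
    have h4 := mul_le_mul_of_nonneg_right hη1 (abs_nonneg s)
    have h5 := mul_le_mul_of_nonneg_right hη2 (sq_nonneg a)
    nlinarith [sq_nonneg a]
  have hneg : κ₁ < 0 := by
    obtain ⟨t, ht, htr, z, hz, hcrit⟩ := hleft r hr
    by_contra hge
    have hpos : 0 < κ₁ := lt_of_le_of_ne (not_lt.1 hge) hF.time_ne.symm
    exact key _ _ (mul_neg_of_pos_of_neg hpos (sub_neg.2 ht)) (h t htr z hz hcrit)
  refine ⟨r, hr, fun t ht htr z hz hcrit => ?_⟩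
  exact key _ _ (mul_neg_of_neg_of_pos hneg (sub_pos.2 ht))
    (h t (by rw [abs_of_pos (sub_pos.2 ht)]; linarith) z hz hcrit)

end IsFold

end Fold

section SingularFlow

variable {E : Type*} [NormedAddCommGroup E] [InnerProductSpace ℝ E]

/-- `uε ε` solves `ε u' = -g(s, u)` on `[0, T]`, for every `ε > 0`. -/
def IsSingularFlow (T : ℝ) (g : ℝ → E → E) (uε : ℝ → ℝ → E) : Prop :=
  ∀ ε : ℝ, 0 < ε → ∀ s ∈ Icc (0 : ℝ) T,
    HasDerivWithinAt (uε ε) (-(ε⁻¹ • g s (uε ε s))) (Icc 0 T) s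

namespace IsSingularFlow

variable {T : ℝ} {g : ℝ → E → E} {uε : ℝ → ℝ → E}

lemma continuousOn (hu : IsSingularFlow T g uε) {ε : ℝ} (hε : 0 < ε) :
    ContinuousOn (uε ε) (Icc 0 T) :=
  fun s hs => (hu ε hε s hs).continuousWithinAt

lemma hasDerivAt (hu : IsSingularFlow T g uε) {ε : ℝ} (hε : 0 < ε) {s : ℝ} (hs : s ∈ Ioo 0 T) :
    HasDerivAt (uε ε) (-(ε⁻¹ • g s (uε ε s))) s :=
  (hu ε hε s (Ioo_subset_Icc_self hs)).hasDerivAt (Icc_mem_nhds hs.1 hs.2)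

/-- The equation in the fast time, run forwards (`σ = 1`) or backwards (`σ = -1`). -/
lemma hasDerivAt_rescale (hu : IsSingularFlow T g uε) {ε : ℝ} (hε : 0 < ε) (t₀ σ : ℝ) {s : ℝ}
    (hs : t₀ + ε * (σ * s) ∈ Ioo 0 T) :
    HasDerivAt (fun s => uε ε (t₀ + ε * (σ * s)))
      (-(σ • g (t₀ + ε * (σ * s)) (uε ε (t₀ + ε * (σ * s))))) s := by
  have h1 : HasDerivAt (fun s : ℝ => t₀ + ε * (σ * s)) (ε * σ) s := by
    simpa using (((hasDerivAt_id s).const_mul σ).const_mul ε).const_add t₀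
  have h2 := (hu.hasDerivAt hε hs).scomp s h1
  refine h2.congr_deriv ?_
  rw [smul_neg, smul_smul]
  congr 2
  field_simp

/-- Solutions starting near a branch of nondegenerate minima follow it. -/
lemma eventually_norm_sub_le [FiniteDimensional ℝ E] (hu : IsSingularFlow T g uε) {q τ : ℝ}
    (hq : 0 ≤ q) (hτT : τ ≤ T)
    (hg : ContDiffOn ℝ 1 (fun p : ℝ × E => g p.1 p.2) (Icc 0 T ×ˢ univ)) {c : ℝ → E}
    (hc : ContDiffOn ℝ 1 c (Ico q τ)) (hcrit : ∀ s ∈ Ico q τ, g s (c s) = 0)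
    (hpos : ∀ s ∈ Ico q τ, ∀ y : E, y ≠ 0 → 0 < ⟪fderiv ℝ (g s) (c s) y, y⟫)
    (hstart : ∀ ρ > 0, ∀ η > 0, ∀ᶠ ε in 𝓝[>] (0 : ℝ), ∃ σ ∈ Icc 0 T, |σ - q| < η ∧
      ‖uε ε σ - c q‖ ≤ ρ) {δ ρ : ℝ} (hδ : 0 < δ) (hρ : 0 < ρ) :
    ∀ᶠ ε in 𝓝[>] (0 : ℝ), ∀ s ∈ Icc (q + δ) (τ - δ), ‖uε ε s - c s‖ ≤ ρ := by
  rcases lt_or_ge (τ - δ) (q + δ) with hlt | hle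
  · refine Eventually.of_forall fun ε s hs => ?_
    linarith [hs.1, hs.2]
  set p := τ - δ with hp
  have hT : 0 < T := by linarith
  have hqp : q < p := by linarith
  have hsub : Icc q p ⊆ Ico q τ := fun s hs => ⟨hs.1, by linarith [hs.2]⟩
  have hsub0 : Icc q p ⊆ Icc 0 T := fun s hs => ⟨hq.trans hs.1, by linarith [hs.2]⟩
  have hqmem : q ∈ Icc q p := ⟨le_rfl, hqp.le⟩
  have hcc : ContinuousOn c (Icc q p) := hc.continuousOn.mono hsub
  obtain ⟨μ, hμ, ρ₁, hρ₁, hmono⟩ := exists_strong_monotone_tube hT hg hcc hsub0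
    (fun s hs => hpos s (hsub hs))
  set r := min ρ ρ₁ with hr
  have hr0 : 0 < r := lt_min hρ hρ₁
  have hout : ∀ s ∈ Icc q p, ∀ z, ‖z - c s‖ = r → μ * r ^ 2 ≤ ⟪z - c s, g s z⟫ := by
    intro s hs z hz
    have := hmono s hs z (hz.le.trans (min_le_right _ _))
    rwa [hcrit s (hsub hs), sub_zero, hz] at this
  obtain ⟨η₁, hη₁, hη₁u⟩ := exists_time_uniform hg.continuousOn
    (isCompact_closedBall (c q) r) (hsub0 hqmem) (show 0 < μ * r / 2 by positivity)
  have hcq : ∃ η₂ > 0, ∀ s ∈ Icc q p, |s - q| < η₂ → ‖c s - c q‖ ≤ r / 2 := by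
    obtain ⟨η₂, h1, h2⟩ := Metric.continuousOn_iff.1 hcc q hqmem (r / 2) (by positivity)
    refine ⟨η₂, h1, fun s hs hsq => ?_⟩
    have := h2 s hs hsq
    rw [dist_eq_norm] at this
    exact this.le
  obtain ⟨η₂, hη₂, hη₂c⟩ := hcq
  have hd : ContinuousOn (derivWithin c (Ico q τ)) (Icc q p) :=
    (hc.continuousOn_derivWithin (uniqueDiffOn_Ico q τ) le_rfl).mono hsub
  obtain ⟨M, hM⟩ := isCompact_Icc.exists_bound_of_continuousOn hd
  have hM0 : 0 ≤ M := (norm_nonneg _).trans (hM q hqmem)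
  set η := min δ (min η₁ η₂) with hη
  have hη0 : 0 < η := by positivity
  have hηδ : η ≤ δ := min_le_left _ _
  have hηη₁ : η ≤ η₁ := (min_le_right _ _).trans (min_le_left _ _)
  have hηη₂ : η ≤ η₂ := (min_le_right _ _).trans (min_le_right _ _)
  have hsmall : ∀ᶠ ε in 𝓝[>] (0 : ℝ), ε * (r * M) < μ * r ^ 2 / 2 := by
    have : Tendsto (fun ε : ℝ => ε * (r * M)) (𝓝[>] 0) (𝓝 (0 * (r * M))) :=
      (tendsto_id.mono_left nhdsWithin_le_nhds).mul_const _
    rw [zero_mul] at this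
    exact this.eventually_lt_const (by positivity)
  filter_upwards [hstart (r / 2) (by positivity) η hη0, hsmall, self_mem_nhdsWithin] with
    ε ⟨σ, hσ, hση, hσr⟩ hεs hε s hs
  have hση' := abs_lt.1 hση
  have hσp : σ ≤ p := by linarith
  have key := norm_sub_le_of_tube (p := σ) (q := p) (ρ := r) (M := M) (m := μ * r ^ 2 / 2)
    (g := g) (u := uε ε) (c := fun s => c (max s q))
    (c' := fun s => if s < q then 0 else derivWithin c (Ico q τ) s) hε hr0.le
    ((hu.continuousOn hε).mono (Icc_subset_Icc hσ.1 (by linarith)))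
    (hcc.comp (by fun_prop) fun s hs => ⟨le_max_right _ _, max_le hs.2 hqp.le⟩)
    (fun s hs => (hu ε hε s ⟨hσ.1.trans hs.1, by linarith [hs.2]⟩).mono_of_mem_nhdsWithin <|
      mem_of_superset (Ico_mem_nhdsGE (show s < T by linarith [hs.2]))
        fun x hx => ⟨(hσ.1.trans hs.1).trans hx.1, hx.2.le⟩)
    ?_ ?_ ?_ hεs ?_ s ⟨by linarith [hs.1], hs.2⟩
  · simp only [max_eq_left (show q ≤ s by linarith [hs.1])] at key
    exact key.trans (min_le_left _ _)
  · intro s hs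
    rcases lt_or_ge s q with hsq | hsq
    · simp only [hsq, if_true]
      refine ((hasDerivAt_const s (c q)).congr_of_eventuallyEq ?_).hasDerivWithinAt
      filter_upwards [Iio_mem_nhds hsq] with x hx
      rw [max_eq_right (le_of_lt hx)]
    · simp only [not_lt.2 hsq, if_false]
      have hsτ : s ∈ Ico q τ := ⟨hsq, by linarith [hs.2]⟩
      have h1 : HasDerivWithinAt c (derivWithin c (Ico q τ) s) (Ici s) s :=
        ((hc.differentiableOn one_ne_zero s hsτ).hasDerivWithinAt).mono_of_mem_nhdsWithin <|
          mem_of_superset (Ico_mem_nhdsGE hsτ.2) fun x hx => ⟨hsq.trans hx.1, hx.2⟩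
      refine h1.congr (fun x hx => ?_) ?_
      · rw [max_eq_left (hsq.trans hx)]
      · rw [max_eq_left hsq]
  · intro s hs z hz
    rcases lt_or_ge s q with hsq | hsq
    · simp only [max_eq_right hsq.le] at hz ⊢
      have h1 := hout q hqmem z hz
      have h2 := hη₁u s ⟨hσ.1.trans hs.1, by linarith [hs.2]⟩ (by
        rw [abs_of_neg (by linarith)]; linarith [hs.1]) z (by
        rw [mem_closedBall_iff_norm]; exact hz.le)
      have h3 := abs_real_inner_le_norm (z - c q) (g s z - g q z)
      rw [hz, inner_sub_right] at h3
      have h4 := mul_le_mul_of_nonneg_left h2 hr0.le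
      have h5 := (abs_le.1 h3).1
      simp only at h4
      nlinarith
    · simp only [max_eq_left hsq] at hz ⊢
      have := hout s ⟨hsq, hs.2.le⟩ z hz
      have h0 : 0 < μ * r ^ 2 := by positivity
      linarith
  · intro s hs
    rcases lt_or_ge s q with hsq | hsq
    · simp only [hsq, if_true, norm_zero]; exact hM0
    · simp only [not_lt.2 hsq, if_false]
      exact hM s ⟨hsq, hs.2.le⟩
  · rcases lt_or_ge σ q with hsq | hsq
    · simp only [max_eq_right hsq.le]; linarith
    · simp only [max_eq_left hsq]
      have h1 := hη₂c σ ⟨hsq, hσp⟩ (by linarith)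
      calc ‖uε ε σ - c σ‖ = ‖(uε ε σ - c q) - (c σ - c q)‖ := by congr 1; abel
        _ ≤ _ := norm_sub_le _ _
        _ ≤ _ := by linarith

/-- Near a point of continuity, a solution cannot stay in a compact set free of critical points
of the potential. -/
lemma eventually_exists_notMem [CompleteSpace E] (hu : IsSingularFlow T g uε)
    (hg : ContinuousOn (fun p : ℝ × E => g p.1 p.2) (Icc 0 T ×ˢ univ)) {F : E → ℝ} {τ : ℝ}
    (hτ : τ ∈ Ioo 0 T) (hF : ∀ z, HasGradientAt F (g τ z) z) {K : Set E} (hK : IsCompact K)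
    (hne : ∀ z ∈ K, g τ z ≠ 0) {η : ℝ} (hη : 0 < η) :
    ∀ᶠ ε in 𝓝[>] (0 : ℝ), ∃ σ ∈ Icc τ (τ + η), σ ≤ T ∧ uε ε σ ∉ K := by
  rcases K.eq_empty_or_nonempty with rfl | hKne
  · exact Eventually.of_forall fun ε => ⟨τ, ⟨le_rfl, by linarith⟩, hτ.2.le, by simp⟩
  have hτc : ContinuousOn (g τ) K := fun z hz =>
    ((hg (τ, z) ⟨Ioo_subset_Icc_self hτ, mem_univ z⟩).comp (f := fun z => (τ, z)) (s := K)
      (by fun_prop) fun z _ => ⟨Ioo_subset_Icc_self hτ, mem_univ z⟩)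
  obtain ⟨z₀, hz₀, hz₀min⟩ := hK.exists_isMinOn hKne hτc.norm
  have hm : 0 < ‖g τ z₀‖ := norm_pos_iff.2 (hne z₀ hz₀)
  set m := ‖g τ z₀‖ with hmdef
  have hmin : ∀ z ∈ K, m ≤ ‖g τ z‖ := fun z hz => hz₀min hz
  obtain ⟨C, hC⟩ := hK.exists_bound_of_continuousOn (f := F)
    fun z _ => (hF z).hasFDerivAt.continuousAt.continuousWithinAt
  obtain ⟨η₁, hη₁, hη₁u⟩ := exists_time_uniform hg hK (Ioo_subset_Icc_self hτ)
    (show 0 < m / 2 by positivity)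
  set h := min η (min η₁ ((T - τ) / 2)) with hh
  have hh0 : 0 < h := by
    have := sub_pos.2 hτ.2
    positivity
  have hhη : h ≤ η := min_le_left _ _
  have hhη₁ : h ≤ η₁ := (min_le_right _ _).trans (min_le_left _ _)
  have hhT : h ≤ (T - τ) / 2 := (min_le_right _ _).trans (min_le_right _ _)
  have hinner : ∀ s ∈ Icc τ (τ + h), ∀ z ∈ K, m ^ 2 / 2 ≤ ⟪g τ z, g s z⟫ := by
    intro s hs z hz
    have h1 := hη₁u s ⟨hτ.1.le.trans hs.1, by linarith [hs.2, hτ.2]⟩ (by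
      rw [abs_of_nonneg (by linarith [hs.1])]; linarith [hs.2]) z hz
    have h2 := abs_real_inner_le_norm (g τ z) (g s z - g τ z)
    rw [inner_sub_right, real_inner_self_eq_norm_sq] at h2
    have h3 := (abs_le.1 h2).1
    have h4 := mul_le_mul_of_nonneg_left h1 (norm_nonneg (g τ z))
    have h5 := hmin z hz
    simp only at h4
    nlinarith
  have hsmall : ∀ᶠ ε in 𝓝[>] (0 : ℝ), ε * (2 * C + 1) < m ^ 2 / 2 * h := by
    have : Tendsto (fun ε : ℝ => ε * (2 * C + 1)) (𝓝[>] 0) (𝓝 (0 * (2 * C + 1))) :=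
      (tendsto_id.mono_left nhdsWithin_le_nhds).mul_const _
    rw [zero_mul] at this
    exact this.eventually_lt_const (by positivity)
  filter_upwards [hsmall, self_mem_nhdsWithin] with ε hεs hε
  by_contra hcon
  push Not at hcon
  have hε' : 0 < ε := hε
  have hin : ∀ s ∈ Icc τ (τ + h), uε ε s ∈ K := fun s hs =>
    hcon s ⟨hs.1, by linarith [hs.2]⟩ (by linarith [hs.2, hτ.2])
  have hder : ∀ s ∈ Icc τ (τ + h), HasDerivAt (fun s => F (uε ε s))
      (-(ε⁻¹ * ⟪g τ (uε ε s), g s (uε ε s)⟫)) s := by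
    intro s hs
    have h1 := (hF (uε ε s)).hasFDerivAt.comp_hasDerivAt s
      (hu.hasDerivAt hε ⟨hτ.1.trans_le hs.1, by linarith [hs.2, hτ.2]⟩)
    refine h1.congr_deriv ?_
    simp [inner_smul_right]
  have key := (convex_Icc τ (τ + h)).image_sub_le_mul_sub_of_deriv_le
    (f := fun s => F (uε ε s)) (C := -(ε⁻¹ * (m ^ 2 / 2)))
    (fun s hs => (hder s hs).continuousAt.continuousWithinAt)
    (fun s hs => (hder s (interior_subset hs)).differentiableAt.differentiableWithinAt)
    (fun s hs => by
      rw [(hder s (interior_subset hs)).deriv]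
      have := hinner s (interior_subset hs) _ (hin s (interior_subset hs))
      gcongr) τ ⟨le_rfl, by linarith⟩ (τ + h) ⟨by linarith, le_rfl⟩ (by linarith)
  have h1 := abs_le.1 (hC _ (hin τ ⟨le_rfl, by linarith⟩))
  have h2 := abs_le.1 (hC _ (hin (τ + h) ⟨by linarith, le_rfl⟩))
  have h3 : ε⁻¹ * (m ^ 2 / 2 * h) ≤ 2 * C := by
    have e : τ + h - τ = h := by ring
    rw [e] at key
    linarith [h1.1, h1.2, h2.1, h2.2]
  rw [inv_mul_le_iff₀ hε'] at h3
  linarith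

end IsSingularFlow

end SingularFlow

section Rescaled

variable {E : Type*} [NormedAddCommGroup E] [InnerProductSpace ℝ E] [FiniteDimensional ℝ E]
  {T : ℝ} {g : ℝ → E → E} {uε : ℝ → ℝ → E}

/-- If the rescaled solutions converge at one point, they converge at all later (`σ = 1`) or
earlier (`σ = -1`) fast times. -/
lemma IsSingularFlow.eventually_rescaled_sub_le_of_sign (hu : IsSingularFlow T g uε) {τ : ℝ}
    (hτ : τ ∈ Ioo 0 T)
    (hg : ContDiffOn ℝ 1 (fun p : ℝ × E => g p.1 p.2) (Icc 0 T ×ˢ univ)) {v : ℝ → E}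
    (hv : ∀ s, HasDerivAt v (-(g τ (v s))) s) {tε : ℝ → ℝ} (htε : Tendsto tε (𝓝[>] 0) (𝓝 τ))
    {s₀ : ℝ} (h0 : Tendsto (fun ε => uε ε (tε ε)) (𝓝[>] 0) (𝓝 (v s₀))) {σ : ℝ}
    (hσ : |σ| = 1) {S e : ℝ} (he : 0 < e) :
    ∀ᶠ ε in 𝓝[>] (0 : ℝ), ∀ s ∈ Icc 0 S, ‖uε ε (tε ε + ε * (σ * s)) - v (s₀ + σ * s)‖ ≤ e := by
  have hvc : Continuous v := continuous_iff_continuousAt.2 fun s => (hv s).continuousAt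
  obtain ⟨R, hR⟩ := (isCompact_Icc (a := (0 : ℝ)) (b := S)).exists_bound_of_continuousOn
    (f := fun s => v (s₀ + σ * s)) (by fun_prop)
  set K := Metric.closedBall (0 : E) (R + 1) with hK
  have hKc : IsCompact K := isCompact_closedBall _ _
  obtain ⟨L, hL⟩ := (contDiff_slice hg (Ioo_subset_Icc_self hτ)).contDiffOn.exists_lipschitzOnWith
    (s := K) one_ne_zero (convex_closedBall _ _) hKc
  set X := Real.exp ((L + 2) * S) with hX
  have hX0 : 0 < X := Real.exp_pos _
  set d := min 1 e / X with hd
  have hd0 : 0 < d := by positivity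
  have hdX : d * X = min 1 e := by rw [hd]; field_simp
  obtain ⟨η, hη, hηu⟩ := exists_time_uniform hg.continuousOn hKc (Ioo_subset_Icc_self hτ) hd0
  have hTT : 0 < min τ (T - τ) := lt_min hτ.1 (sub_pos.2 hτ.2)
  set η' := min η (min τ (T - τ)) with hη'
  have hη'0 : 0 < η' := lt_min hη hTT
  have h1 : ∀ᶠ ε in 𝓝[>] (0 : ℝ), |tε ε - τ| < η' / 2 := by
    have := Metric.tendsto_nhds.1 htε (η' / 2) (by positivity)
    simpa [Real.dist_eq] using this
  have h2 : ∀ᶠ ε in 𝓝[>] (0 : ℝ), ‖uε ε (tε ε) - v s₀‖ < d := by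
    have := Metric.tendsto_nhds.1 h0 d hd0
    simpa [dist_eq_norm] using this
  have h3 : ∀ᶠ ε in 𝓝[>] (0 : ℝ), ε * S < η' / 2 := by
    have : Tendsto (fun ε : ℝ => ε * S) (𝓝[>] 0) (𝓝 (0 * S)) :=
      (tendsto_id.mono_left nhdsWithin_le_nhds).mul_const _
    rw [zero_mul] at this
    exact this.eventually_lt_const (by positivity)
  filter_upwards [h1, h2, h3, self_mem_nhdsWithin] with ε h1 h2 h3 hε s hs
  have hε' : 0 < ε := hε
  have htime : ∀ s ∈ Icc 0 S, |tε ε + ε * (σ * s) - τ| < η' := by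
    intro s hs
    have e1 : |ε * (σ * s)| ≤ ε * S := by
      rw [abs_mul, abs_mul, hσ, one_mul, abs_of_pos hε', abs_of_nonneg hs.1]
      exact mul_le_mul_of_nonneg_left hs.2 hε'.le
    calc |tε ε + ε * (σ * s) - τ| = |(tε ε - τ) + ε * (σ * s)| := by congr 1; ring
      _ ≤ _ := abs_add_le _ _
      _ < η' := by linarith
  have hmem : ∀ s ∈ Icc 0 S, tε ε + ε * (σ * s) ∈ Ioo 0 T := by
    intro s hs
    have e1 := abs_lt.1 (htime s hs)
    have e2 : η' ≤ τ := (min_le_right _ _).trans (min_le_left _ _)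
    have e3 : η' ≤ T - τ := (min_le_right _ _).trans (min_le_right _ _)
    exact ⟨by linarith [e1.1], by linarith [e1.2]⟩
  have hvσ : ∀ s, HasDerivAt (fun s => v (s₀ + σ * s)) (-(σ • g τ (v (s₀ + σ * s)))) s := by
    intro s
    have e1 : HasDerivAt (fun s : ℝ => s₀ + σ * s) σ s := by
      simpa using ((hasDerivAt_id s).const_mul σ).const_add s₀
    exact ((hv _).scomp s e1).congr_deriv (by rw [smul_neg])
  have key := norm_sub_le_exp_of_tube (S := S) (L := L) (e := d) (ρ := 1) hd0 L.2
    (fun s hs => hu.hasDerivAt_rescale hε' (tε ε) σ (hmem s hs)) (fun s _ => hvσ s) ?_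
    (by simpa using h2.le) (by rw [← hX, hdX]; exact min_le_left _ _) s hs
  · refine key.trans (le_trans ?_ (hdX.le.trans (min_le_right _ _)))
    apply mul_le_mul_of_nonneg_left _ hd0.le
    apply Real.exp_le_exp.2
    apply mul_le_mul_of_nonneg_left hs.2
    have := L.2
    positivity
  · intro s hs hclose
    set w := uε ε (tε ε + ε * (σ * s))
    have hvK : v (s₀ + σ * s) ∈ K := by
      rw [hK, mem_closedBall_zero_iff]
      linarith [hR s hs]
    have hwK : w ∈ K := by
      rw [hK, mem_closedBall_zero_iff]
      calc ‖w‖ = ‖(w - v (s₀ + σ * s)) + v (s₀ + σ * s)‖ := by rw [sub_add_cancel]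
        _ ≤ _ := norm_add_le _ _
        _ ≤ _ := by linarith [hR s hs]
    have e1 := hηu _ (Ioo_subset_Icc_self (hmem s hs))
      ((htime s hs).le.trans (min_le_left _ _)) w hwK
    have e2 := hL.norm_sub_le hwK hvK
    rw [← neg_sub_neg, neg_neg, neg_neg, ← smul_sub, norm_smul, Real.norm_eq_abs, hσ, one_mul,
      norm_sub_rev]
    calc _ = ‖(g (tε ε + ε * (σ * s)) w - g τ w) + (g τ w - g τ (v (s₀ + σ * s)))‖ := by
          congr 1; abel
      _ ≤ _ := norm_add_le _ _
      _ ≤ _ := by linarith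

/-- If the rescaled solutions converge at one point, they converge locally uniformly. -/
lemma IsSingularFlow.eventually_rescaled_sub_le (hu : IsSingularFlow T g uε) {τ : ℝ}
    (hτ : τ ∈ Ioo 0 T)
    (hg : ContDiffOn ℝ 1 (fun p : ℝ × E => g p.1 p.2) (Icc 0 T ×ˢ univ)) {v : ℝ → E}
    (hv : ∀ s, HasDerivAt v (-(g τ (v s))) s) {tε : ℝ → ℝ} (htε : Tendsto tε (𝓝[>] 0) (𝓝 τ))
    {s₀ : ℝ} (h0 : Tendsto (fun ε => uε ε (tε ε)) (𝓝[>] 0) (𝓝 (v s₀)))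
    {S e : ℝ} (he : 0 < e) :
    ∀ᶠ ε in 𝓝[>] (0 : ℝ), ∀ s, |s| ≤ S → ‖uε ε (tε ε - ε * s₀ + ε * s) - v s‖ ≤ e := by
  filter_upwards [hu.eventually_rescaled_sub_le_of_sign hτ hg hv htε h0 (σ := 1) (S := |S| + |s₀| + 1) (by simp) he,
    hu.eventually_rescaled_sub_le_of_sign hτ hg hv htε h0 (σ := -1)
      (S := |S| + |s₀| + 1) (by simp) he] with
    ε h1 h2 s hs
  have hb : |s - s₀| ≤ |S| + |s₀| + 1 := by
    have := abs_sub s s₀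
    have := le_abs_self S
    linarith
  rcases le_total s₀ s with h | h
  · have := h1 (s - s₀) ⟨sub_nonneg.2 h, (le_abs_self _).trans hb⟩
    convert this using 4 <;> ring
  · have := h2 (s₀ - s) ⟨sub_nonneg.2 h, by rw [abs_sub_comm] at hb; exact (le_abs_self _).trans hb⟩
    convert this using 4 <;> ring

/-- A nonconstant solution of an autonomous equation does not meet an equilibrium. -/
lemma ne_of_nonconstant {G : E → E} (hG : ContDiff ℝ 1 G) {v : ℝ → E}
    (hv : ∀ s, HasDerivAt v (-(G (v s))) s) {s₁ s₂ : ℝ} (hne : v s₁ ≠ v s₂) {x₀ : E}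
    (hx₀ : G x₀ = 0) (s : ℝ) : v s ≠ x₀ := by
  intro hs
  have hvc : Continuous v := continuous_iff_continuousAt.2 fun s => (hv s).continuousAt
  have h : ∀ r, v r = x₀ := by
    intro r
    set a := min r s - 1
    set b := max r s + 1
    obtain ⟨R, hR⟩ := (isCompact_Icc (a := a) (b := b)).exists_bound_of_continuousOn
      hvc.continuousOn
    set K := Metric.closedBall (0 : E) (max R ‖x₀‖)
    obtain ⟨L, hL⟩ := hG.neg.contDiffOn.exists_lipschitzOnWith (s := K) one_ne_zero
      (convex_closedBall _ _) (isCompact_closedBall _ _)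
    have hmem : ∀ q, min r s ≤ q → q ≤ max r s → q ∈ Ioo a b := fun q h1 h2 =>
      ⟨by simp only [a]; linarith, by simp only [b]; linarith⟩
    refine ODE_solution_unique_of_mem_Ioo (a := a) (b := b) (v := fun _ z => -(G z))
      (s := fun _ => K) (K := L) (f := v) (g := fun _ => x₀) (t₀ := s)
      (fun _ _ => hL) (hmem s (min_le_right _ _) (le_max_right _ _))
      (fun q hq => ⟨hv q, ?_⟩) (fun q _ => ⟨?_, ?_⟩) hs (hmem r (min_le_left _ _) (le_max_left _ _))
    · rw [mem_closedBall_zero_iff]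
      exact (hR q (Ioo_subset_Icc_self hq)).trans (le_max_left _ _)
    · rw [hx₀, neg_zero]; exact hasDerivAt_const _ _
    · rw [mem_closedBall_zero_iff]; exact le_max_right _ _
  exact hne ((h s₁).trans (h s₂).symm)

end Rescaled

section Exit

variable {E : Type*} [NormedAddCommGroup E] [InnerProductSpace ℝ E]

/-- A ball around a fold on which the difference of two solutions is attracted by the cone of
slope `θ` around the kernel line, while the flow in that cone goes in the direction of `ℓ`. -/
structure IsConeNhd (G : E → E) (x₀ ℓ : E) (A : E →L[ℝ] E) (lam θ κ r c : ℝ) : Prop where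
  norm_eq : ‖ℓ‖ = 1
  orth : ∀ D, ⟪A D, ℓ⟫ = 0
  lam_pos : 0 < lam
  gap : ∀ D, lam * (‖D‖ ^ 2 - ⟪D, ℓ⟫ ^ 2) ≤ ⟪A D, D⟫
  crit : G x₀ = 0
  slope_pos : 0 < θ
  slope_le : θ ≤ 1
  approx_le : 6 * κ ≤ lam * θ ^ 2
  radius_pos : 0 < r
  rate_pos : 0 < c
  approx : ∀ z₁ ∈ Metric.closedBall x₀ r, ∀ z₂ ∈ Metric.closedBall x₀ r,
    ‖G z₁ - G z₂ - A (z₁ - z₂)‖ ≤ κ * ‖z₁ - z₂‖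
  sign : ∀ z, ‖z - x₀‖ ≤ r → ‖z - x₀‖ ^ 2 ≤ (1 + 4 * θ ^ 2) * ⟪z - x₀, ℓ⟫ ^ 2 →
    c * ⟪z - x₀, ℓ⟫ ^ 2 ≤ -⟪G z, ℓ⟫

lemma IsFold.exists_isConeNhd {T : ℝ} {g : ℝ → E → E} {τ : ℝ} {x₀ ℓ : E} {A : E →L[ℝ] E}
    {lam κ₁ κ₃ : ℝ} (hF : IsFold T g τ x₀ ℓ A lam κ₁ κ₃) :
    ∃ θ κ r c, IsConeNhd (g τ) x₀ ℓ A lam θ κ r c := by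
  obtain ⟨θ, hθ, hθ1, r₁, hr₁, c, hc, hsign⟩ := hF.exists_cone_sign
  have hlam := hF.lam_pos
  obtain ⟨r₂, hr₂, happ⟩ := hF.exists_linear_approx (show 0 < lam * θ ^ 2 / 6 by positivity)
  exact ⟨θ, lam * θ ^ 2 / 6, min r₁ r₂, c, hF.norm_eq, hF.orth, hlam, hF.gap, hF.crit, hθ, hθ1,
    by linarith, lt_min hr₁ hr₂, hc,
    fun z₁ h₁ z₂ h₂ => happ z₁ (Metric.closedBall_subset_closedBall (min_le_right _ _) h₁) z₂
      (Metric.closedBall_subset_closedBall (min_le_right _ _) h₂),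
    fun z hz => hsign z (hz.trans (min_le_left _ _))⟩

namespace IsConeNhd

variable {G : E → E} {x₀ ℓ : E} {A : E →L[ℝ] E} {lam θ κ r c : ℝ}

lemma coneForm_sub_le (hC : IsConeNhd G x₀ ℓ A lam θ κ r c) {a b e : ℝ} {w v w' v' : ℝ → E}
    (hab : a ≤ b) (he : 0 ≤ e)
    (hw : ∀ s ∈ Icc a b, HasDerivAt w (-(w' s)) s) (hv : ∀ s ∈ Icc a b, HasDerivAt v (-(v' s)) s)
    (hwr : ∀ s ∈ Icc a b, ‖w s - x₀‖ ≤ r) (hvr : ∀ s ∈ Icc a b, ‖v s - x₀‖ ≤ r)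
    (hwe : ∀ s ∈ Icc a b, ‖w' s - G (w s)‖ ≤ e) (hve : ∀ s ∈ Icc a b, ‖v' s - G (v s)‖ ≤ e) :
    coneForm θ ℓ (w b - v b) ≤ Real.exp (-lam * (b - a)) * (4 * r ^ 2) + 24 * r * e / lam :=
  _root_.coneForm_sub_le hab he hC.lam_pos hC.slope_pos hC.slope_le hC.norm_eq hC.orth hC.gap
    hC.approx_le hC.approx hw hv (fun s hs => mem_closedBall_iff_norm.2 (hwr s hs))
    (fun s hs => mem_closedBall_iff_norm.2 (hvr s hs)) hwe hve

lemma tendsto_coneForm_bound (hC : IsConeNhd G x₀ ℓ A lam θ κ r c) :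
    Tendsto (fun S => Real.exp (-lam * S) * (4 * r ^ 2)) atTop (𝓝 0) := by
  have h1 : Tendsto (fun S => Real.exp (-(lam * S))) atTop (𝓝 0) :=
    Real.tendsto_exp_neg_atTop_nhds_zero.comp (tendsto_id.const_mul_atTop hC.lam_pos)
  simpa [neg_mul] using h1.mul_const (4 * r ^ 2)

/-- A solution emanating from the fold lies in the cone. -/
lemma coneForm_le_zero (hC : IsConeNhd G x₀ ℓ A lam θ κ r c) {v : ℝ → E}
    (hv : ∀ s, HasDerivAt v (-(G (v s))) s) {s₁ : ℝ} (hvr : ∀ s ≤ s₁, ‖v s - x₀‖ ≤ r) {s : ℝ}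
    (hs : s ≤ s₁) : coneForm θ ℓ (v s - x₀) ≤ 0 := by
  refine ge_of_tendsto hC.tendsto_coneForm_bound ?_
  filter_upwards [eventually_ge_atTop 0] with S hS
  have := hC.coneForm_sub_le (a := s - S) (b := s) (e := 0) (w := v) (v := fun _ => x₀)
    (w' := fun s => G (v s)) (v' := fun _ => 0) (by linarith) le_rfl (fun q _ => hv q)
    (fun q _ => by rw [neg_zero]; exact hasDerivAt_const _ _)
    (fun q hq => hvr q (hq.2.trans hs)) (fun q _ => by simp [hC.radius_pos.le])
    (fun q _ => by simp) (fun q _ => by simp [hC.crit])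
  simpa using this

/-- A nonconstant solution emanating from the fold leaves it in the direction of `ℓ`. -/
lemma exists_inner_pos [FiniteDimensional ℝ E] (hC : IsConeNhd G x₀ ℓ A lam θ κ r c)
    (hG : ContDiff ℝ 1 G) {v : ℝ → E}
    (hv : ∀ s, HasDerivAt v (-(G (v s))) s) (hlim : Tendsto v atBot (𝓝 x₀)) {q₁ q₂ : ℝ}
    (hne : v q₁ ≠ v q₂) {R : ℝ} (hR : 0 < R) :
    ∃ s₀, (∀ s ≤ s₀, ‖v s - x₀‖ ≤ R) ∧ 0 < ⟪v s₀ - x₀, ℓ⟫ := by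
  have hmin : 0 < min R r := lt_min hR hC.radius_pos
  obtain ⟨s₁, hs₁⟩ : ∃ s₁, ∀ s ≤ s₁, ‖v s - x₀‖ ≤ min R r := by
    obtain ⟨s₁, h⟩ := eventually_atBot.1 (Metric.tendsto_nhds.1 hlim _ hmin)
    exact ⟨s₁, fun s hs => by rw [← dist_eq_norm]; exact (h s hs).le⟩
  have hcone : ∀ s ≤ s₁, ‖v s - x₀‖ ^ 2 ≤ (1 + θ ^ 2) * ⟪v s - x₀, ℓ⟫ ^ 2 := by
    intro s hs
    have := hC.coneForm_le_zero hv (fun s hs => (hs₁ s hs).trans (min_le_right _ _)) hs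
    unfold coneForm at this
    linarith
  by_contra hcon
  push Not at hcon
  have hle : ∀ s ≤ s₁, ⟪v s - x₀, ℓ⟫ ≤ 0 := fun s hs =>
    hcon s fun q hq => (hs₁ q (hq.trans hs)).trans (min_le_left _ _)
  have hder : ∀ s, HasDerivAt (fun s => ⟪v s - x₀, ℓ⟫) (-⟪G (v s), ℓ⟫) s := by
    intro s
    have := ((hv s).sub_const x₀).inner ℝ (hasDerivAt_const s ℓ)
    simpa using this
  have hmono : MonotoneOn (fun s => ⟪v s - x₀, ℓ⟫) (Iic s₁) := by
    refine monotoneOn_of_deriv_nonneg (convex_Iic s₁)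
      (fun s _ => (hder s).continuousAt.continuousWithinAt)
      (fun s _ => (hder s).differentiableAt.differentiableWithinAt) fun s hs => ?_
    have hs' : s ∈ Iic s₁ := interior_subset hs
    rw [(hder s).deriv]
    have h1 := hC.sign (v s) ((hs₁ s hs').trans (min_le_right _ _)) (by
      nlinarith [hcone s hs', sq_nonneg θ, sq_nonneg (⟪v s - x₀, ℓ⟫),
        mul_nonneg (sq_nonneg θ) (sq_nonneg (⟪v s - x₀, ℓ⟫))])
    have := hC.rate_pos
    exact le_trans (by positivity) h1
  have hlim0 : Tendsto (fun s => ⟪v s - x₀, ℓ⟫) atBot (𝓝 0) := by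
    have := (hlim.sub_const x₀).inner (𝕜 := ℝ) (tendsto_const_nhds (x := ℓ))
    simpa using this
  have hge : 0 ≤ ⟪v s₁ - x₀, ℓ⟫ := by
    refine le_of_tendsto hlim0 ?_
    filter_upwards [eventually_le_atBot s₁] with s hs
    exact hmono hs self_mem_Iic hs
  have h0 : ⟪v s₁ - x₀, ℓ⟫ = 0 := le_antisymm (hle s₁ le_rfl) hge
  have h1 := hcone s₁ le_rfl
  rw [h0] at h1
  have h2 : ‖v s₁ - x₀‖ = 0 := by
    have : ‖v s₁ - x₀‖ ^ 2 = 0 := le_antisymm (by simpa using h1) (sq_nonneg _)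
    exact pow_eq_zero_iff two_ne_zero |>.1 this
  exact ne_of_nonconstant hG hv hne hC.crit s₁ (sub_eq_zero.1 (norm_eq_zero.1 h2))

/-- A trajectory which stays for a long time in a small box around the fold leaves it near the
solution emanating from the fold. -/
lemma exists_norm_sub_le (hC : IsConeNhd G x₀ ℓ A lam θ κ r c) {v : ℝ → E}
    (hv : ∀ s, HasDerivAt v (-(G (v s))) s) {s₀ α : ℝ} (hvr : ∀ s ≤ s₀, ‖v s - x₀‖ ≤ r)
    (hα : ⟪v s₀ - x₀, ℓ⟫ = α) (hα0 : 0 < α) (hαr : 2 * α ≤ r) {δ : ℝ} (hδ : 0 < δ) :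
    ∃ S > 0, ∃ e > 0, ∀ w w' : ℝ → E, (∀ s ∈ Icc (-S) 0, HasDerivAt w (-(w' s)) s) →
      (∀ s ∈ Icc (-S) 0, ‖w s - x₀‖ ≤ r → ‖w' s - G (w s)‖ ≤ e) →
      (∀ s ∈ Ico (-S) 0, |⟪w s - x₀, ℓ⟫| < α ∧ ‖w s - x₀‖ < 2 * α) →
      ¬ (|⟪w 0 - x₀, ℓ⟫| < α ∧ ‖w 0 - x₀‖ < 2 * α) → ‖w 0 - v s₀‖ ≤ δ := by
  have hlam := hC.lam_pos
  have hθ := hC.slope_pos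
  have hc := hC.rate_pos
  have hr := hC.radius_pos
  set η := min (θ ^ 2 * α ^ 2) (δ ^ 2) with hη
  have hη0 : 0 < η := by positivity
  obtain ⟨S, hS, hSη⟩ : ∃ S > 0, Real.exp (-lam * S) * (4 * r ^ 2) < η / 2 :=
    ((eventually_gt_atTop 0).and
      (hC.tendsto_coneForm_bound.eventually_lt_const (by positivity))).exists
  set e := min (c * α ^ 2 / 2) (lam * η / (48 * r)) with he
  have he0 : 0 < e := by positivity
  have he1 : 24 * r * e / lam ≤ η / 2 := by
    have : e * (48 * r) ≤ lam * η := by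
      rw [← le_div_iff₀ (by positivity)]; exact min_le_right _ _
    rw [div_le_iff₀ hlam]
    linarith
  refine ⟨S, hS, e, he0, fun w w' hw hwe hbox hexit => ?_⟩
  have h0mem : (0 : ℝ) ∈ Icc (-S) 0 := ⟨by linarith, le_rfl⟩
  have hcw : ContinuousAt w 0 := (hw 0 h0mem).continuousAt
  have hev : ∀ᶠ s in 𝓝[<] (0 : ℝ), s ∈ Ico (-S) 0 :=
    mem_of_superset (Ioo_mem_nhdsLT (show -S < 0 by linarith)) Ioo_subset_Ico_self
  have ha0 : |⟪w 0 - x₀, ℓ⟫| ≤ α := by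
    have : Tendsto (fun s => |⟪w s - x₀, ℓ⟫|) (𝓝[<] 0) (𝓝 |⟪w 0 - x₀, ℓ⟫|) :=
      (((hcw.sub_const x₀).inner (𝕜 := ℝ) continuousAt_const).abs).mono_left nhdsWithin_le_nhds
    exact le_of_tendsto this (hev.mono fun s hs => (hbox s hs).1.le)
  have hn0 : ‖w 0 - x₀‖ ≤ 2 * α := by
    have : Tendsto (fun s => ‖w s - x₀‖) (𝓝[<] 0) (𝓝 ‖w 0 - x₀‖) :=
      ((hcw.sub_const x₀).norm).mono_left nhdsWithin_le_nhds
    exact le_of_tendsto this (hev.mono fun s hs => (hbox s hs).2.le)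
  have hwr : ∀ s ∈ Icc (-S) 0, ‖w s - x₀‖ ≤ r := by
    intro s hs
    rcases hs.2.lt_or_eq with h | h
    · exact ((hbox s ⟨hs.1, h⟩).2.le).trans hαr
    · rw [h]; exact hn0.trans hαr
  have hcone₁ : coneForm θ ℓ (w 0 - x₀) ≤ η := by
    have := hC.coneForm_sub_le (a := -S) (b := 0) (e := e) (w := w) (v := fun _ => x₀)
      (w' := w') (v' := fun _ => 0) (by linarith) he0.le hw
      (fun q _ => by rw [neg_zero]; exact hasDerivAt_const _ _) hwr (fun q _ => by simp [hr.le])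
      (fun q hq => hwe q hq (hwr q hq)) (fun q _ => by simp [hC.crit, he0.le])
    rw [zero_sub, neg_neg] at this
    linarith
  have hcone₂ : coneForm θ ℓ (w 0 - v s₀) ≤ η := by
    have hvs : ∀ s, HasDerivAt (fun s => v (s₀ + s)) (-(G (v (s₀ + s)))) s := fun s =>
      (hv (s₀ + s)).comp_const_add s₀ s
    have := hC.coneForm_sub_le (a := -S) (b := 0) (e := e) (w := w) (v := fun s => v (s₀ + s))
      (w' := w') (v' := fun s => G (v (s₀ + s))) (by linarith) he0.le hw
      (fun q _ => hvs q) hwr (fun q hq => hvr _ (by linarith [hq.2]))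
      (fun q hq => hwe q hq (hwr q hq)) (fun q _ => by simp [he0.le])
    rw [zero_sub, neg_neg, add_zero] at this
    linarith
  have hη1 : η ≤ θ ^ 2 * α ^ 2 := min_le_left _ _
  unfold coneForm at hcone₁ hcone₂
  set a := ⟪w 0 - x₀, ℓ⟫ with hadef
  have hasq : a ^ 2 ≤ α ^ 2 := sq_le_sq' (abs_le.1 ha0).1 (abs_le.1 ha0).2
  have hθsq : θ ^ 2 ≤ 1 := pow_le_one₀ hθ.le hC.slope_le
  have hnorm : ‖w 0 - x₀‖ < 2 * α := by
    apply lt_of_pow_lt_pow_left₀ 2 (by positivity)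
    have : θ ^ 2 * a ^ 2 ≤ 1 * α ^ 2 := by gcongr
    have : θ ^ 2 * α ^ 2 ≤ 1 * α ^ 2 := by gcongr
    have : 0 < α ^ 2 := by positivity
    nlinarith
  have haα : |a| = α := by
    by_contra h
    exact hexit ⟨lt_of_le_of_ne ha0 h, hnorm⟩
  have hasq' : a ^ 2 = α ^ 2 := by rw [← haα, sq_abs]
  have haeq : a = α := by
    rcases abs_eq hα0.le |>.1 haα with h | h
    · exact h
    exfalso
    have h1 := hC.sign (w 0) (hwr 0 h0mem) (by
      rw [← hadef, hasq'] ; rw [hasq'] at hcone₁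
      nlinarith [mul_nonneg (sq_nonneg θ) (sq_nonneg α)])
    rw [← hadef, hasq'] at h1
    have h2 := abs_real_inner_le_norm (w' 0 - G (w 0)) ℓ
    rw [hC.norm_eq, mul_one, inner_sub_left] at h2
    have h3 := (abs_le.1 (h2.trans (hwe 0 h0mem (hwr 0 h0mem)))).2
    have h4 : e ≤ c * α ^ 2 / 2 := min_le_left _ _
    have h5 : 0 < c * α ^ 2 := by positivity
    have hd : HasDerivAt (fun s => ⟪w s - x₀, ℓ⟫) (-⟪w' 0, ℓ⟫) 0 := by
      have := ((hw 0 h0mem).sub_const x₀).inner ℝ (hasDerivAt_const 0 ℓ)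
      simpa using this
    have hslope := (hasDerivAt_iff_tendsto_slope.1 hd).eventually_const_lt
      (show 0 < -⟪w' 0, ℓ⟫ by linarith)
    have hslope' := hslope.filter_mono (nhdsWithin_mono (0 : ℝ) (s := Iio 0)
      fun x hx => ne_of_lt hx)
    obtain ⟨s, hs1, hs2⟩ := (hslope'.and hev).exists
    rw [slope_def_field, sub_zero] at hs1
    have h6 := (abs_lt.1 (hbox s hs2).1).1
    have h7 : (⟪w s - x₀, ℓ⟫ - ⟪w 0 - x₀, ℓ⟫) / s ≤ 0 :=
      div_nonpos_of_nonneg_of_nonpos (by rw [← hadef, h]; linarith) hs2.2.le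
    linarith
  have hinner : ⟪w 0 - v s₀, ℓ⟫ = 0 := by
    have : w 0 - v s₀ = (w 0 - x₀) - (v s₀ - x₀) := by abel
    rw [this, inner_sub_left, ← hadef, hα, haeq, sub_self]
  rw [hinner] at hcone₂
  apply le_of_sq_le_sq _ hδ.le
  have : η ≤ δ ^ 2 := min_le_right _ _
  linarith

end IsConeNhd

end Exit

section Jump

variable {E : Type*} [NormedAddCommGroup E] [InnerProductSpace ℝ E] [FiniteDimensional ℝ E]

/-- Solutions following a branch of critical points up to a fold leave the fold near the solution
`v` emanating from it. -/
lemma IsFold.exists_exit_times {T : ℝ} {g : ℝ → E → E} {uε : ℝ → ℝ → E} {τ : ℝ} {x₀ ℓ : E}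
    {A : E →L[ℝ] E} {lam κ₁ κ₃ : ℝ} (hF : IsFold T g τ x₀ ℓ A lam κ₁ κ₃)
    (hu : IsSingularFlow T g uε) {f : ℝ → E → ℝ}
    (hf : ∀ t ∈ Icc 0 T, ∀ z, HasGradientAt (f t) (g t z) z) {q : ℝ} (hq : 0 ≤ q) (hqτ : q < τ)
    {c : ℝ → E} (hc : Tendsto c (𝓝[<] τ) (𝓝 x₀)) (hcrit : ∀ s ∈ Ico q τ, g s (c s) = 0)
    (htrack : ∀ δ > 0, ∀ ρ > 0, ∀ᶠ ε in 𝓝[>] (0 : ℝ), ∀ s ∈ Icc (q + δ) (τ - δ),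
      ‖uε ε s - c s‖ ≤ ρ)
    {v : ℝ → E} (hv : ∀ s, HasDerivAt v (-(g τ (v s))) s) (hlim : Tendsto v atBot (𝓝 x₀))
    {q₁ q₂ : ℝ} (hne : v q₁ ≠ v q₂) :
    ∃ (s₀ : ℝ) (tε : ℝ → ℝ), Tendsto tε (𝓝[>] 0) (𝓝 τ) ∧
      Tendsto (fun ε => uε ε (tε ε)) (𝓝[>] 0) (𝓝 (v s₀)) := by
  have hτ := hF.mem
  obtain ⟨θ, κ, r, c', hC⟩ := hF.exists_isConeNhd
  have hr := hC.radius_pos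
  obtain ⟨R, hR, hnc⟩ := hF.exists_no_critical (by
    intro r hr
    have h1 : ∀ᶠ s in 𝓝[<] τ, ‖c s - x₀‖ < r := by
      have := Metric.tendsto_nhds.1 hc r hr
      simpa [dist_eq_norm] using this
    have h2 : ∀ᶠ s in 𝓝[<] τ, s ∈ Ioo (max q (τ - r)) τ :=
      Ioo_mem_nhdsLT (max_lt hqτ (by linarith))
    obtain ⟨s, h1, h2⟩ := (h1.and h2).exists
    have h3 := (le_max_left q (τ - r)).trans_lt h2.1
    have h4 := (le_max_right q (τ - r)).trans_lt h2.1
    exact ⟨s, h2.2, by rw [abs_of_neg (by linarith [h2.2])]; linarith, c s, h1.le,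
      hcrit s ⟨h3.le, h2.2⟩⟩)
  obtain ⟨s₀, hs₀, hpos⟩ := hC.exists_inner_pos (hF.contDiff_slice.of_le (by norm_num)) hv hlim
    hne (show 0 < min (r / 2) (R / 2) by positivity)
  set α := ⟪v s₀ - x₀, ℓ⟫ with hα
  have hαle : α ≤ min (r / 2) (R / 2) := by
    have := real_inner_le_norm (v s₀ - x₀) ℓ
    rw [hC.norm_eq, mul_one] at this
    exact this.trans (hs₀ s₀ le_rfl)
  have hαr : 2 * α ≤ r := by linarith [hαle.trans (min_le_left _ _)]
  have hαR : 2 * α ≤ R := by linarith [hαle.trans (min_le_right _ _)]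
  obtain ⟨d, hd, hdc⟩ : ∃ d > 0, ∀ s ∈ Ico (τ - d) τ, ‖c s - x₀‖ ≤ α / 3 := by
    have h1 : ∀ᶠ s in 𝓝[<] τ, ‖c s - x₀‖ < α / 3 := by
      have := Metric.tendsto_nhds.1 hc (α / 3) (by positivity)
      simpa [dist_eq_norm] using this
    obtain ⟨l, hl, h2⟩ := (mem_nhdsLT_iff_exists_Ioo_subset).1 h1
    refine ⟨(τ - l) / 2, by linarith [mem_Iio.1 hl], fun s hs => (h2 ⟨?_, hs.2⟩).le⟩
    linarith [hs.1, mem_Iio.1 hl]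
  set δ₀ := min d ((τ - q) / 2) with hδ₀
  have hδ₀0 : 0 < δ₀ := lt_min hd (by linarith)
  have hδ₀q : δ₀ ≤ (τ - q) / 2 := min_le_right _ _
  set p := τ - δ₀ with hp
  have hp0 : 0 < p := by linarith
  set B : Set E := {z | |⟪z - x₀, ℓ⟫| < α ∧ ‖z - x₀‖ < 2 * α} with hB
  have hBo : IsOpen B := by
    refine IsOpen.inter (s := {z | |⟪z - x₀, ℓ⟫| < α}) (t := {z | ‖z - x₀‖ < 2 * α}) ?_ ?_
    · exact isOpen_lt (by fun_prop) continuous_const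
    · exact isOpen_lt (by fun_prop) continuous_const
  have hBmem : ∀ z, ‖z - x₀‖ < α → z ∈ B := by
    intro z hz
    have := abs_real_inner_le_norm (z - x₀) ℓ
    rw [hC.norm_eq, mul_one] at this
    exact ⟨this.trans_lt hz, by linarith⟩
  have hlow : ∀ δ > 0, ∀ᶠ ε in 𝓝[>] (0 : ℝ), ∀ s ∈ Icc p (τ - δ), uε ε s ∈ B := by
    intro δ hδ
    filter_upwards [htrack (min δ ((τ - q) / 2)) (lt_min hδ (by linarith)) (α / 3)
      (by positivity)] with ε h s hs
    have h1 := h s ⟨by linarith [hs.1, min_le_right δ ((τ - q) / 2)],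
      by linarith [hs.2, min_le_left δ ((τ - q) / 2)]⟩
    have h2 := hdc s ⟨by linarith [hs.1, min_le_left d ((τ - q) / 2)], by linarith [hs.2]⟩
    apply hBmem
    calc ‖uε ε s - x₀‖ = ‖(uε ε s - c s) + (c s - x₀)‖ := by rw [sub_add_sub_cancel]
      _ ≤ _ := norm_add_le _ _
      _ < α := by linarith
  have hescape : ∀ δ > 0, ∀ᶠ ε in 𝓝[>] (0 : ℝ), ∃ σ ∈ Icc p T, σ ≤ τ + δ ∧ uε ε σ ∉ B := by
    intro δ hδ
    have hTτ : 0 < T - τ := sub_pos.2 hτ.2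
    set h := min δ (min R (T - τ)) / 2 with hh
    have hh0 : 0 < h := by positivity
    have h2h : 2 * h = min δ (min R (T - τ)) := by rw [hh]; ring
    have h1 : 2 * h ≤ δ := h2h.le.trans (min_le_left _ _)
    have h2 : 2 * h ≤ R := h2h.le.trans ((min_le_right _ _).trans (min_le_left _ _))
    have h3 : 2 * h ≤ T - τ := h2h.le.trans ((min_le_right _ _).trans (min_le_right _ _))
    have hmem : τ + h ∈ Ioo 0 T := ⟨by linarith [hτ.1], by linarith⟩
    filter_upwards [hu.eventually_exists_notMem hF.contDiffOn.continuousOn hmem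
      (hf _ (Ioo_subset_Icc_self hmem)) (isCompact_closedBall x₀ R)
      (fun z hz => hnc _ (by linarith) (by linarith) z (mem_closedBall_iff_norm.1 hz)) hh0] with
      ε ⟨σ, hσ, hσT, hσK⟩
    refine ⟨σ, ⟨by linarith [hσ.1], hσT⟩, by linarith [hσ.2], fun hσB => hσK ?_⟩
    rw [mem_closedBall_iff_norm]
    exact hσB.2.le.trans hαR
  set Z : ℝ → Set ℝ := fun ε => {σ | σ ∈ Icc p T ∧ uε ε σ ∉ B} with hZ
  have hleast : ∀ᶠ ε in 𝓝[>] (0 : ℝ), IsLeast (Z ε) (sInf (Z ε)) := by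
    filter_upwards [hescape 1 one_pos, self_mem_nhdsWithin] with ε ⟨σ, hσ, _, hσB⟩ hε
    have hcl : IsClosed (Z ε) :=
      (((hu.continuousOn hε).mono (Icc_subset_Icc_left hp0.le)).preimage_isClosed_of_isClosed
        isClosed_Icc hBo.isClosed_compl)
    have hbd : BddBelow (Z ε) := ⟨p, fun x hx => hx.1.1⟩
    exact ⟨hcl.csInf_mem ⟨σ, hσ, hσB⟩ hbd, fun x hx => csInf_le hbd hx⟩
  have htend : ∀ δ > 0, ∀ᶠ ε in 𝓝[>] (0 : ℝ), |sInf (Z ε) - τ| ≤ δ := by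
    intro δ hδ
    filter_upwards [hleast, hlow δ hδ, hescape δ hδ] with ε hl h1 ⟨σ, hσ, hσδ, hσB⟩
    have h2 := hl.2 ⟨hσ, hσB⟩
    have h3 : τ - δ < sInf (Z ε) := by
      by_contra hcon
      exact hl.1.2 (h1 _ ⟨hl.1.1.1, not_lt.1 hcon⟩)
    exact abs_le.2 ⟨by linarith, by linarith⟩
  refine ⟨s₀, fun ε => sInf (Z ε), ?_, ?_⟩
  · refine Metric.tendsto_nhds.2 fun δ hδ => ?_
    filter_upwards [htend (δ / 2) (by positivity)] with ε h
    rw [Real.dist_eq]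
    linarith
  · refine Metric.tendsto_nhds.2 fun δ hδ => ?_
    obtain ⟨S, hS, e, he, hfin⟩ := hC.exists_norm_sub_le hv
      (fun s hs => (hs₀ s hs).trans ((min_le_left _ _).trans (by linarith))) hα.symm hpos hαr
      (half_pos hδ)
    obtain ⟨η, hη, hηu⟩ := exists_time_uniform hF.contDiffOn.continuousOn
      (isCompact_closedBall x₀ r) (Ioo_subset_Icc_self hτ) he
    have hTτ : 0 < T - τ := sub_pos.2 hτ.2
    set η' := min (min η δ₀) (min τ (T - τ)) with hη'
    have hτ0 := hτ.1
    have hη'0 : 0 < η' := by positivity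
    have k1 : η' ≤ η := (min_le_left _ _).trans (min_le_left _ _)
    have k2 : η' ≤ δ₀ := (min_le_left _ _).trans (min_le_right _ _)
    have k3 : η' ≤ τ := (min_le_right _ _).trans (min_le_left _ _)
    have k4 : η' ≤ T - τ := (min_le_right _ _).trans (min_le_right _ _)
    have hsmall : ∀ᶠ ε in 𝓝[>] (0 : ℝ), ε * S < η' / 3 := by
      have : Tendsto (fun ε : ℝ => ε * S) (𝓝[>] 0) (𝓝 (0 * S)) :=
        (tendsto_id.mono_left nhdsWithin_le_nhds).mul_const _
      rw [zero_mul] at this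
      exact this.eventually_lt_const (by positivity)
    filter_upwards [hleast, htend (η' / 3) (by positivity), hsmall, self_mem_nhdsWithin] with
      ε hl h1 h2 hε
    have hε' : 0 < ε := hε
    set t₀ := sInf (Z ε) with ht₀
    have h1' := abs_le.1 h1
    have htime : ∀ s ∈ Icc (-S) 0, |t₀ + ε * (1 * s) - τ| < η' := by
      intro s hs
      have e1 : ε * (-S) ≤ ε * s := mul_le_mul_of_nonneg_left hs.1 hε'.le
      have e2 : ε * s ≤ 0 := mul_nonpos_of_nonneg_of_nonpos hε'.le hs.2
      rw [abs_lt]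
      constructor <;> linarith [h1'.1, h1'.2]
    have hmem : ∀ s ∈ Icc (-S) 0, t₀ + ε * (1 * s) ∈ Ioo 0 T := by
      intro s hs
      have := abs_lt.1 (htime s hs)
      exact ⟨by linarith [this.1], by linarith [this.2]⟩
    have key := hfin (fun s => uε ε (t₀ + ε * (1 * s)))
      (fun s => g (t₀ + ε * (1 * s)) (uε ε (t₀ + ε * (1 * s))))
      (fun s hs => by simpa using hu.hasDerivAt_rescale hε' t₀ 1 (hmem s hs))
      (fun s hs hsr => hηu _ (Ioo_subset_Icc_self (hmem s hs))
        ((htime s hs).le.trans k1) _ (mem_closedBall_iff_norm.2 hsr))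
      (fun s hs => by
        by_contra hcon
        have h3 := abs_lt.1 (htime s (Ico_subset_Icc_self hs))
        have h4 : t₀ + ε * (1 * s) ∈ Z ε :=
          ⟨⟨by linarith [h3.1], by linarith [h3.2]⟩, hcon⟩
        have h5 := hl.2 h4
        have h6 : ε * s < 0 := mul_neg_of_pos_of_neg hε' hs.2
        linarith)
      (by rw [mul_zero, mul_zero, add_zero]; exact hl.1.2)
    simp only [mul_zero, add_zero] at key
    rw [dist_eq_norm]
    linarith

end Jump

section Gradient

variable {E : Type*} [NormedAddCommGroup E] [InnerProductSpace ℝ E] [FiniteDimensional ℝ E]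

/-- A transversal degenerate minimum of `f τ` is a fold of the gradient family. -/
lemma exists_isFold {T : ℝ} (hT : 0 < T) {f : ℝ → E → ℝ}
    (hf : ContDiffOn ℝ 3 (Function.uncurry f) (Icc 0 T ×ˢ univ)) {τ : ℝ} (hτ : τ ∈ Ioo 0 T)
    {x₀ ℓ₀ : E} (hcrit : gradient (f τ) x₀ = 0)
    (hpsd : ∀ y, 0 ≤ ⟪fderiv ℝ (gradient (f τ)) x₀ y, y⟫) (hℓ₀ : ℓ₀ ≠ 0)
    (hAℓ₀ : fderiv ℝ (gradient (f τ)) x₀ ℓ₀ = 0)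
    (hker : ∀ y, fderiv ℝ (gradient (f τ)) x₀ y = 0 → ∃ c : ℝ, y = c • ℓ₀)
    (htime : ⟪gradient (fun z => deriv (fun s => f s z) τ) x₀, ℓ₀⟫ ≠ 0)
    (hthird : iteratedFDeriv ℝ 3 (f τ) x₀ ![ℓ₀, ℓ₀, ℓ₀] ≠ 0) :
    ∃ ℓ A lam κ₁ κ₃, IsFold T (fun t => gradient (f t)) τ x₀ ℓ A lam κ₁ κ₃ := by
  have hfτ : ContDiff ℝ 3 (f τ) := contDiff_slice hf (Ioo_subset_Icc_self hτ)
  have hg := contDiffOn_gradient_slice hT hf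
  have hgτ : ContDiff ℝ 2 (gradient (f τ)) := contDiff_slice hg (Ioo_subset_Icc_self hτ)
  have hn : 0 < ‖ℓ₀‖ := norm_pos_iff.2 hℓ₀
  set A := fderiv ℝ (gradient (f τ)) x₀ with hA
  set d := iteratedFDeriv ℝ 3 (f τ) x₀ ![ℓ₀, ℓ₀, ℓ₀] with hd
  obtain ⟨a, ha0, han, had⟩ : ∃ a : ℝ, a ≠ 0 ∧ |a| * ‖ℓ₀‖ = 1 ∧ a ^ 3 * d < 0 := by
    have hi : 0 < ‖ℓ₀‖⁻¹ := inv_pos.2 hn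
    rcases lt_or_gt_of_ne hthird with h | h
    · refine ⟨‖ℓ₀‖⁻¹, hi.ne', ?_, mul_neg_of_pos_of_neg (by positivity) h⟩
      rw [abs_of_pos hi, inv_mul_cancel₀ hn.ne']
    · refine ⟨-‖ℓ₀‖⁻¹, (neg_lt_zero.2 hi).ne, ?_, mul_neg_of_neg_of_pos ?_ h⟩
      · rw [abs_neg, abs_of_pos hi, inv_mul_cancel₀ hn.ne']
      · have : 0 < ‖ℓ₀‖⁻¹ ^ 3 := by positivity
        rw [neg_pow]
        linarith
  set ℓ := a • ℓ₀ with hℓ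
  have hℓ1 : ‖ℓ‖ = 1 := by rw [hℓ, norm_smul, Real.norm_eq_abs, han]
  have hAℓ : A ℓ = 0 := by rw [hℓ, map_smul, hAℓ₀, smul_zero]
  have hsymm : ∀ y w, ⟪A y, w⟫ = ⟪A w, y⟫ :=
    inner_fderiv_gradient_comm (hfτ.of_le (by norm_num)) x₀
  obtain ⟨lam, hlam, hgap⟩ := exists_transversal_gap hℓ1 hsymm hpsd hAℓ (by
    intro y hy
    obtain ⟨c, hc⟩ := hker y hy
    refine ⟨c * a⁻¹, ?_⟩
    rw [hℓ, smul_smul, mul_assoc, inv_mul_cancel₀ ha0, mul_one, hc])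
  have hd3 : iteratedFDeriv ℝ 3 (f τ) x₀ ![ℓ, ℓ, ℓ] = a ^ 3 * d := by
    have h1 := (iteratedFDeriv ℝ 3 (f τ) x₀).map_smul_univ (fun _ => a) ![ℓ₀, ℓ₀, ℓ₀]
    have h2 : (fun i => a • ![ℓ₀, ℓ₀, ℓ₀] i) = ![ℓ, ℓ, ℓ] := by
      ext i
      fin_cases i <;> rfl
    rw [h2] at h1
    rw [h1]
    simp [hd]
  refine ⟨ℓ, A, lam, ⟪gradient (fun z => deriv (fun s => f s z) τ) x₀, ℓ⟫, -(a ^ 3 * d), ?_⟩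
  exact
    { contDiffOn := hg
      mem := hτ
      crit := hcrit
      norm_eq := hℓ1
      hasFDerivAt := (hgτ.differentiable (by norm_num) x₀).hasFDerivAt
      orth := fun D => by rw [hsymm, hAℓ, inner_zero_left]
      lam_pos := hlam
      gap := hgap
      hasDerivAt_time := hasDerivAt_inner_gradient hf hτ x₀ ℓ
      time_ne := by
        rw [hℓ, inner_smul_right]
        exact mul_ne_zero ha0 htime
      quad := by rw [fderiv_fderiv_inner_gradient hfτ, hd3, neg_neg]
      quad_pos := by linarith }

end Gradient

/-- Theorem `tm:main`, part 2: for every `i = 1,…,k−1` there are times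
`t_ε^i → t_i` such that the rescaled solutions `s ↦ u_ε(t_ε^i + ε s)` converge to the
heteroclinic `v_i` uniformly on every compact subset of `ℝ` as `ε → 0⁺`. -/
theorem main_theorem_rescaled_convergence
    {n : ℕ} (hn : 1 ≤ n) {T : ℝ} (hT : 0 < T)
    (f : ℝ → EuclideanSpace ℝ (Fin n) → ℝ)
    (hf : ContDiffOn ℝ 3 (Function.uncurry f)
      (Set.Icc 0 T ×ˢ (Set.univ : Set (EuclideanSpace ℝ (Fin n)))))
    {a₀ c₀ : ℝ} (ha₀ : 0 ≤ a₀) (hc₀ : 0 < c₀)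
    (hA1 : ∀ t ∈ Set.Icc (0:ℝ) T, ∀ x : EuclideanSpace ℝ (Fin n),
      ⟪gradient (f t) x, x⟫ ≥ c₀ * ‖x‖ ^ 2 - a₀)
    (hA2 : ∀ p ∈ degenerateCriticalSet T f, HessPosSemidef f p.1 p.2 →
      ∃ ℓ : EuclideanSpace ℝ (Fin n), ℓ ≠ 0 ∧
        LinearMap.ker ((fderiv ℝ (gradient (f p.1)) p.2 :
            EuclideanSpace ℝ (Fin n) →L[ℝ] EuclideanSpace ℝ (Fin n)) :
            EuclideanSpace ℝ (Fin n) →ₗ[ℝ] EuclideanSpace ℝ (Fin n)) = Submodule.span ℝ {ℓ} ∧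
        ⟪gradft f p.1 p.2, ℓ⟫ ≠ 0 ∧ thirdDeriv f p.1 p.2 ℓ ≠ 0)
    (hA3fin : (degenerateCriticalSet T f).Finite)
    (hA3inj : ∀ p ∈ degenerateCriticalSet T f, ∀ q ∈ degenerateCriticalSet T f,
      p.1 = q.1 → p = q)
    (hA3end : ∀ p ∈ degenerateCriticalSet T f, p.1 ≠ 0 ∧ p.1 ≠ T)
    (hA4 : ∀ p ∈ degenerateCriticalSet T f, HessPosSemidef f p.1 p.2 →
      ∀ w : ℝ → EuclideanSpace ℝ (Fin n),
        (∀ s : ℝ, HasDerivAt w (-(gradient (f p.1) (w s))) s) →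
        Tendsto w atBot (nhds p.2) → (∃ s₁ s₂ : ℝ, w s₁ ≠ w s₂) →
        ∃ wlim : EuclideanSpace ℝ (Fin n),
          Tendsto w atTop (nhds wlim) ∧ HessPosDef f p.1 wlim)
    (y₀ : EuclideanSpace ℝ (Fin n))
    (hy₀ : gradient (f 0) y₀ = 0) (hy₀pd : HessPosDef f 0 y₀)
    (k : ℕ) (hk : 1 ≤ k) (t : ℕ → ℝ)
    (ht0 : t 0 = 0) (htk : t k = T) (htmono : ∀ i < k, t i < t (i + 1))
    (ui vi : ℕ → ℝ → EuclideanSpace ℝ (Fin n))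
    (x y : ℕ → EuclideanSpace ℝ (Fin n))
    (hu1 : ui 1 0 = y₀)
    (huiC2 : ∀ i, 1 ≤ i → i ≤ k → ContDiffOn ℝ 2 (ui i) (Set.Ico (t (i - 1)) (t i)))
    (huicrit : ∀ i, 1 ≤ i → i ≤ k → ∀ s ∈ Set.Ico (t (i - 1)) (t i),
      gradient (f s) (ui i s) = 0 ∧ HessPosDef f s (ui i s))
    (hx : ∀ i, 1 ≤ i → i ≤ k →
      Tendsto (ui i) (nhdsWithin (t i) (Set.Iio (t i))) (nhds (x i)))
    (hxdeg : ∀ i, 1 ≤ i → i ≤ k - 1 →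
      (t i, x i) ∈ degenerateCriticalSet T f ∧ HessPosSemidef f (t i) (x i))
    (hy : ∀ i, 1 ≤ i → i ≤ k - 1 → y i = ui (i + 1) (t i))
    (hviC2 : ∀ i, 1 ≤ i → i ≤ k - 1 → ContDiff ℝ 2 (vi i))
    (hvinc : ∀ i, 1 ≤ i → i ≤ k - 1 → ∃ s₁ s₂ : ℝ, vi i s₁ ≠ vi i s₂)
    (hvode : ∀ i, 1 ≤ i → i ≤ k - 1 →
      ∀ s : ℝ, HasDerivAt (vi i) (-(gradient (f (t i)) (vi i s))) s)
    (hvlim : ∀ i, 1 ≤ i → i ≤ k - 1 →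
      Tendsto (vi i) atBot (nhds (x i)) ∧ Tendsto (vi i) atTop (nhds (y i)))
    (u : ℝ → EuclideanSpace ℝ (Fin n))
    (hupiece : ∀ i, 1 ≤ i → i ≤ k → ∀ s ∈ Set.Ico (t (i - 1)) (t i), u s = ui i s)
    (huT : u T = x k)
    (uε : ℝ → ℝ → EuclideanSpace ℝ (Fin n)) (yε : ℝ → EuclideanSpace ℝ (Fin n))
    (hode : ∀ ε : ℝ, 0 < ε → ∀ s ∈ Set.Icc (0:ℝ) T,
      HasDerivWithinAt (uε ε) (-(ε⁻¹ • gradient (f s) (uε ε s))) (Set.Icc 0 T) s)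
    (hinit : ∀ ε : ℝ, 0 < ε → uε ε 0 = yε ε)
    (hyε : Tendsto yε (nhdsWithin 0 (Set.Ioi 0)) (nhds y₀)) :
    ∀ i, 1 ≤ i → i ≤ k - 1 →
      ∃ tε : ℝ → ℝ,
        Tendsto tε (nhdsWithin 0 (Set.Ioi 0)) (nhds (t i)) ∧
        ∀ K : Set ℝ, IsCompact K →
          TendstoUniformlyOn (fun ε s => uε ε (tε ε + ε * s)) (vi i)
            (nhdsWithin 0 (Set.Ioi 0)) K := by
  have hg := contDiffOn_gradient_slice hT hf
  have hg1 := hg.of_le (show (1 : WithTop ℕ∞) ≤ 2 by norm_num)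
  have hu : IsSingularFlow T (fun s => gradient (f s)) uε := hode
  have hgrad : ∀ s ∈ Icc 0 T, ∀ z, HasGradientAt (f s) (gradient (f s) z) z := fun s hs z =>
    ((contDiff_slice hf hs).differentiable (by norm_num) z).hasGradientAt
  have hmono : MonotoneOn t (Iic k) := by
    refine monotoneOn_of_le_add_one ordConnected_Iic fun i _ _ hi => (htmono i ?_).le
    exact Nat.lt_of_succ_le hi
  have ht0' : ∀ i ≤ k, 0 ≤ t i := fun i hi => ht0 ▸ hmono (Nat.zero_le k) hi (Nat.zero_le i)
  have htT : ∀ i ≤ k, t i ≤ T := fun i hi => htk ▸ hmono hi self_mem_Iic hi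
  have htIoo : ∀ j, j + 1 ≤ k - 1 → t (j + 1) ∈ Ioo 0 T := fun j hj =>
    ⟨(ht0' j (by omega)).trans_lt (htmono j (by omega)),
      (htmono (j + 1) (by omega)).trans_le (htT (j + 1 + 1) (by omega))⟩
  have hjump : ∀ j, j + 1 ≤ k - 1 →
      (∀ ρ > 0, ∀ η > 0, ∀ᶠ ε in 𝓝[>] (0 : ℝ), ∃ σ ∈ Icc 0 T, |σ - t j| < η ∧
        ‖uε ε σ - ui (j + 1) (t j)‖ ≤ ρ) →
      ∃ tε : ℝ → ℝ, Tendsto tε (𝓝[>] 0) (𝓝 (t (j + 1))) ∧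
        ∀ S : ℝ, ∀ e > 0, ∀ᶠ ε in 𝓝[>] (0 : ℝ), ∀ s, |s| ≤ S →
          ‖uε ε (tε ε + ε * s) - vi (j + 1) s‖ ≤ e := by
    intro j hj hstart
    have h1 : 1 ≤ j + 1 := by omega
    have hjk : j + 1 ≤ k := by omega
    have hτ := htIoo j hj
    obtain ⟨hdeg, hpsd⟩ := hxdeg (j + 1) h1 hj
    obtain ⟨ℓ₀, hℓ₀, hker, htime, hthird⟩ := hA2 _ hdeg hpsd
    have hkerm : ∀ w, fderiv ℝ (gradient (f (t (j + 1)))) (x (j + 1)) w = 0 ↔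
        w ∈ Submodule.span ℝ {ℓ₀} := fun w => by
      rw [← hker]; rfl
    obtain ⟨ℓ, A, lam, κ₁, κ₃, hF⟩ := exists_isFold hT hf hτ hdeg.2.1 hpsd hℓ₀
      ((hkerm ℓ₀).2 (Submodule.mem_span_singleton_self ℓ₀))
      (fun w hw => by
        obtain ⟨c, hc⟩ := Submodule.mem_span_singleton.1 ((hkerm w).1 hw)
        exact ⟨c, hc.symm⟩) htime hthird
    have hcrit := huicrit (j + 1) h1 hjk
    have huC := huiC2 (j + 1) h1 hjk
    rw [Nat.add_sub_cancel] at hcrit huC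
    obtain ⟨q₁, q₂, hne⟩ := hvinc (j + 1) h1 hj
    obtain ⟨s₀, tε, htε, hexit⟩ := hF.exists_exit_times hu hgrad (ht0' j (by omega))
      (htmono j (by omega)) (hx (j + 1) h1 hjk) (fun s hs => (hcrit s hs).1)
      (fun δ hδ ρ hρ => hu.eventually_norm_sub_le (ht0' j (by omega)) hτ.2.le hg1
        (huC.of_le (by norm_num)) (fun s hs => (hcrit s hs).1) (fun s hs => (hcrit s hs).2)
        hstart hδ hρ)
      (hvode (j + 1) h1 hj) (hvlim (j + 1) h1 hj).1 hne
    refine ⟨fun ε => tε ε - ε * s₀, ?_, fun S e he =>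
      hu.eventually_rescaled_sub_le hτ hg1 (hvode (j + 1) h1 hj) htε hexit he⟩
    have h2 : Tendsto (fun ε : ℝ => ε * s₀) (𝓝[>] 0) (𝓝 (0 * s₀)) :=
      (tendsto_id.mono_left nhdsWithin_le_nhds).mul_const _
    simpa using htε.sub h2
  have hstart : ∀ j, j + 1 ≤ k → ∀ ρ > 0, ∀ η > 0, ∀ᶠ ε in 𝓝[>] (0 : ℝ),
      ∃ σ ∈ Icc 0 T, |σ - t j| < η ∧ ‖uε ε σ - ui (j + 1) (t j)‖ ≤ ρ := by
    intro j
    induction j with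
    | zero =>
      intro _ ρ hρ η hη
      filter_upwards [Metric.tendsto_nhds.1 hyε ρ hρ, self_mem_nhdsWithin] with ε h hε
      refine ⟨0, ⟨le_rfl, hT.le⟩, by simpa [ht0] using hη, ?_⟩
      rw [hinit ε hε, ht0, zero_add, hu1, ← dist_eq_norm]
      exact h.le
    | succ j ih =>
      intro hj ρ hρ η hη
      have hj' : j + 1 ≤ k - 1 := by omega
      obtain ⟨tε, htε, hconv⟩ := hjump j hj' (ih (by omega))
      have hlim := (hvlim (j + 1) (by omega) hj').2
      rw [hy (j + 1) (by omega) hj'] at hlim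
      obtain ⟨s, hs⟩ := (Metric.tendsto_nhds.1 hlim (ρ / 2) (by positivity)).exists
      have h2 : Tendsto (fun ε : ℝ => tε ε + ε * s) (𝓝[>] 0) (𝓝 (t (j + 1))) := by
        have : Tendsto (fun ε : ℝ => ε * s) (𝓝[>] 0) (𝓝 (0 * s)) :=
          (tendsto_id.mono_left nhdsWithin_le_nhds).mul_const _
        simpa using htε.add this
      have hτ := htIoo j hj'
      filter_upwards [hconv |s| (ρ / 2) (by positivity), Metric.tendsto_nhds.1 h2 η hη,
        h2.eventually (Icc_mem_nhds hτ.1 hτ.2)] with ε h3 h4 h5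
      refine ⟨tε ε + ε * s, h5, by rwa [Real.dist_eq] at h4, ?_⟩
      rw [dist_eq_norm] at hs
      calc _ = ‖(uε ε (tε ε + ε * s) - vi (j + 1) s) +
            (vi (j + 1) s - ui (j + 1 + 1) (t (j + 1)))‖ := by rw [sub_add_sub_cancel]
        _ ≤ _ := norm_add_le _ _
        _ ≤ ρ := by linarith [h3 s le_rfl]
  intro i hi hik
  obtain ⟨j, rfl⟩ : ∃ j, i = j + 1 := ⟨i - 1, by omega⟩
  obtain ⟨tε, htε, hconv⟩ := hjump j hik (hstart j (by omega))
  refine ⟨tε, htε, fun K hK => ?_⟩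
  obtain ⟨S, hS⟩ := hK.isBounded.exists_norm_le
  refine Metric.tendstoUniformlyOn_iff.2 fun e he => ?_
  filter_upwards [hconv S (e / 2) (by positivity)] with ε h s hs
  rw [dist_comm, dist_eq_norm]
  linarith [h s (hS s hs)]
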